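/- arXiv:0912.2444 — 3 statements merged into one kernel-verified Lean document; each statement's English description precedes it below -/
import Mathlib

section
/- Fix a real constant c > 0 and an integer K ≥ 2. For each N let G(N, ⌊cN⌋) be a random K-SAT instance with N variables and ⌊cN⌋ clauses, and let H_N denote the maximum number of simultaneously satisfiable clauses. Then there exists a constant H(c) such that H_N / N converges to H(c) with high probability as N → ∞. -/
open Filter
open scoped Classical

/-- A clause of a `K`-SAT instance on variables `Fin N`: `K` variable indices together
with the forbidden tuple `a ∈ {0,1}^K`. -/
abbrev Clause (N K : ℕ) := (Fin K → Fin N) × (Fin K → Bool)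

/-- Probability of an event `p` for a random `K`-SAT instance with `N` variables and `M`
clauses: the `M` clauses (variable indices and forbidden tuples) are drawn independently
and uniformly at random. -/
noncomputable def probKSAT (N K M : ℕ) (p : (Fin M → Clause N K) → Prop) : ℝ :=
  (((Finset.univ : Finset (Fin M → Clause N K)).filter p).card : ℝ) /
    (Fintype.card (Fin M → Clause N K) : ℝ)

/-- The maximum number of simultaneously satisfiable clauses: an assignment `x` satisfies
clause `m` iff the values of `x` on the clause's variables differ from the forbidden
tuple. -/
noncomputable def ksatMax {N K M : ℕ} (C : Fin M → Clause N K) : ℕ :=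
  Finset.sup (Finset.univ : Finset (Fin N → Bool)) (fun x =>
    ((Finset.univ : Finset (Fin M)).filter
      (fun m => (fun k => x ((C m).1 k)) ≠ (C m).2)).card)

/-- An assignment satisfies a clause when it does not produce the forbidden tuple. -/
def SatClause {N K : ℕ} (x : Fin N → Bool) (c : Clause N K) : Prop :=
  (fun k => x (c.1 k)) ≠ c.2

/-- The maximum number of simultaneously satisfiable clauses of a multiset of clauses. -/
noncomputable def multisetMax {N K : ℕ} (L : Multiset (Clause N K)) : ℕ :=
  Finset.sup (Finset.univ : Finset (Fin N → Bool)) (fun x => L.countP (SatClause x))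

/-- The operator averaging a functional of multisets over the insertion of a uniformly random
element `g a`, with `a` ranging over a finite type. -/
noncomputable def avgOp {α β : Type*} [Fintype α] (g : α → β) :
    Module.End ℝ (Multiset β → ℝ) where
  toFun f L := (∑ a, f (g a ::ₘ L)) / Fintype.card α
  map_add' f f' := by
    funext L
    simp [Finset.sum_add_distrib, add_div]
  map_smul' r f := by
    funext L
    simp [← Finset.mul_sum, mul_div_assoc]

section AvgOp

variable {α α' β : Type*} [Fintype α] [Fintype α']

theorem avgOp_apply (g : α → β) (f : Multiset β → ℝ) (L : Multiset β) :
    avgOp g f L = (∑ a, f (g a ::ₘ L)) / Fintype.card α := rfl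

theorem avgOp_commute (g : α → β) (g' : α' → β) : Commute (avgOp g) (avgOp g') := by
  refine LinearMap.ext fun f => funext fun L => ?_
  simp only [Module.End.mul_apply, avgOp_apply, ← Finset.sum_div]
  rw [Finset.sum_comm, div_div, div_div, mul_comm]
  simp only [Multiset.cons_swap]

theorem avgOp_mono (g : α → β) {f f' : Multiset β → ℝ} (h : f ≤ f') :
    avgOp g f ≤ avgOp g f' := fun L => by
  simp only [avgOp_apply]
  gcongr with a
  exact h _

theorem avgOp_pow_mono (g : α → β) (M : ℕ) {f f' : Multiset β → ℝ} (h : f ≤ f') :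
    (avgOp g ^ M) f ≤ (avgOp g ^ M) f' := by
  induction M with
  | zero => simpa using h
  | succ M ih =>
    rw [pow_succ', Module.End.mul_apply, Module.End.mul_apply]
    exact avgOp_mono g ih

theorem sum_div_card_le [Nonempty α] {f : α → ℝ} {r : ℝ} (h : ∀ a, f a ≤ r) :
    (∑ a, f a) / Fintype.card α ≤ r := by
  have hc : (0 : ℝ) < Fintype.card α := by exact_mod_cast Fintype.card_pos
  rw [div_le_iff₀ hc]
  calc ∑ a, f a ≤ ∑ _a : α, r := Finset.sum_le_sum fun a _ => h a
    _ = r * Fintype.card α := by simp [mul_comm]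

theorem le_sum_div_card [Nonempty α] {f : α → ℝ} {r : ℝ} (h : ∀ a, r ≤ f a) :
    r ≤ (∑ a, f a) / Fintype.card α := by
  have hc : (0 : ℝ) < Fintype.card α := by exact_mod_cast Fintype.card_pos
  rw [le_div_iff₀ hc]
  calc r * Fintype.card α = ∑ _a : α, r := by simp [mul_comm]
    _ ≤ ∑ a, f a := Finset.sum_le_sum fun a _ => h a

/-- Inserting an element changes the functional by an amount in `[0, 1]`. -/
def UnitIncrements (f : Multiset β → ℝ) : Prop :=
  ∀ b L, f L ≤ f (b ::ₘ L) ∧ f (b ::ₘ L) ≤ f L + 1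

theorem UnitIncrements.avgOp [Nonempty α] (g : α → β) {f : Multiset β → ℝ}
    (h : UnitIncrements f) : UnitIncrements (avgOp g f) := by
  intro b L
  have hc : (0 : ℝ) < Fintype.card α := by exact_mod_cast Fintype.card_pos
  simp only [avgOp_apply]
  constructor
  · gcongr with a
    rw [Multiset.cons_swap]
    exact (h _ _).1
  · rw [div_add_one hc.ne']
    gcongr
    calc ∑ a, f (g a ::ₘ b ::ₘ L) ≤ ∑ a, (f (g a ::ₘ L) + 1) :=
          Finset.sum_le_sum fun a _ => by
            rw [Multiset.cons_swap]
            exact (h _ _).2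
      _ = _ := by simp [Finset.sum_add_distrib]

theorem UnitIncrements.avgOp_pow [Nonempty α] (g : α → β) {f : Multiset β → ℝ}
    (h : UnitIncrements f) (M : ℕ) : UnitIncrements ((_root_.avgOp g ^ M) f) := by
  induction M with
  | zero => simpa using h
  | succ M ih =>
    rw [pow_succ', Module.End.mul_apply]
    exact ih.avgOp g

theorem UnitIncrements.avgOp_pow_succ [Nonempty α] (g : α → β) {f : Multiset β → ℝ}
    (h : UnitIncrements f) (M : ℕ) (L : Multiset β) :
    (_root_.avgOp g ^ M) f L ≤ (_root_.avgOp g ^ (M + 1)) f L ∧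
      (_root_.avgOp g ^ (M + 1)) f L ≤ (_root_.avgOp g ^ M) f L + 1 := by
  rw [pow_succ', Module.End.mul_apply, avgOp_apply]
  exact ⟨le_sum_div_card fun a => (h.avgOp_pow g M _ _).1,
    sum_div_card_le fun a => (h.avgOp_pow g M _ _).2⟩

theorem sum_sq_div_card_le [Nonempty α] {f : α → ℝ} {r : ℝ}
    (h : ∀ a, r ≤ f a ∧ f a ≤ r + 1) :
    (∑ a, f a ^ 2) / Fintype.card α ≤ ((∑ a, f a) / Fintype.card α) ^ 2 + 1 := by
  have hc : (0 : ℝ) < Fintype.card α := by exact_mod_cast Fintype.card_pos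
  set m := (∑ a, f a) / Fintype.card α with hm
  have h1 : r ≤ m := le_sum_div_card fun a => (h a).1
  have h2 : m ≤ r + 1 := sum_div_card_le fun a => (h a).2
  have hs : ∑ a, f a = m * Fintype.card α := by rw [hm]; field_simp
  have h3 : ∑ a, (f a ^ 2 - 2 * m * f a + m ^ 2) ≤ ∑ _a : α, (1 : ℝ) := by
    refine Finset.sum_le_sum fun a _ => ?_
    have := h a
    nlinarith
  simp only [Finset.sum_add_distrib, Finset.sum_sub_distrib, ← Finset.mul_sum, hs,
    Finset.sum_const, Finset.card_univ, nsmul_eq_mul, mul_one] at h3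
  rw [div_le_iff₀ hc]
  nlinarith

/-- Variance bound for functionals with unit increments of `M` independent elements. -/
theorem UnitIncrements.avgOp_pow_sq_le [Nonempty α] (g : α → β) {f : Multiset β → ℝ}
    (h : UnitIncrements f) (M : ℕ) (L : Multiset β) :
    (_root_.avgOp g ^ M) (fun L => f L ^ 2) L ≤ (_root_.avgOp g ^ M) f L ^ 2 + M := by
  induction M generalizing L with
  | zero => simp
  | succ M ih =>
    have hc : (0 : ℝ) < Fintype.card α := by exact_mod_cast Fintype.card_pos
    rw [pow_succ', Module.End.mul_apply, Module.End.mul_apply, avgOp_apply, avgOp_apply]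
    have h1 := sum_sq_div_card_le fun a => h.avgOp_pow g M (g a) L
    have h2 : (∑ a, (_root_.avgOp g ^ M) (fun L => f L ^ 2) (g a ::ₘ L)) / Fintype.card α ≤
        (∑ a, ((_root_.avgOp g ^ M) f (g a ::ₘ L) ^ 2 + M)) / Fintype.card α := by
      gcongr
      exact ih _
    rw [Finset.sum_add_distrib, add_div] at h2
    have h3 : (∑ _a : α, (M : ℝ)) / Fintype.card α = M := by
      simp [hc.ne']
    rw [h3] at h2
    push_cast
    linarith

/-- Iterating the averaging operator is averaging over independent tuples. -/
theorem avgOp_pow_eq_sum_pi (g : α → β) (M : ℕ) (f : Multiset β → ℝ) (L : Multiset β) :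
    (avgOp g ^ M) f L =
      (∑ C : Fin M → α, f (Finset.univ.val.map (fun m => g (C m)) + L)) /
        Fintype.card (Fin M → α) := by
  induction M generalizing L with
  | zero => simp
  | succ M ih =>
    rw [pow_succ', Module.End.mul_apply, avgOp_apply]
    simp only [ih]
    rw [← (Fin.consEquiv fun _ => α).sum_comp, Fintype.sum_prod_type, ← Finset.sum_div, div_div]
    congr 1
    · refine Finset.sum_congr rfl fun a _ => Finset.sum_congr rfl fun C _ => ?_
      congr 1
      simp [Fin.univ_succ, Fin.consEquiv, Function.comp_def]
      rw [← Multiset.cons_add]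
      rfl
    · simp [pow_succ]

end AvgOp

section MultisetMax

variable {N N' K : ℕ}

theorem exists_countP_eq_multisetMax (L : Multiset (Clause N K)) :
    ∃ x, L.countP (SatClause x) = multisetMax L := by
  obtain ⟨x, -, hx⟩ := Finset.exists_mem_eq_sup (Finset.univ : Finset (Fin N → Bool))
    Finset.univ_nonempty (fun x => L.countP (SatClause x))
  exact ⟨x, hx.symm⟩

theorem countP_le_multisetMax (L : Multiset (Clause N K)) (x : Fin N → Bool) :
    L.countP (SatClause x) ≤ multisetMax L :=
  Finset.le_sup (f := fun x => L.countP (SatClause x)) (Finset.mem_univ x)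

theorem multisetMax_zero : multisetMax (0 : Multiset (Clause N K)) = 0 := by
  obtain ⟨x, hx⟩ := exists_countP_eq_multisetMax (0 : Multiset (Clause N K))
  simpa using hx.symm

/-- The assignments satisfying the maximal number of clauses. -/
def optimal (L : Multiset (Clause N K)) : Set (Fin N → Bool) :=
  {x | L.countP (SatClause x) = multisetMax L}

theorem multisetMax_cons (c : Clause N K) (L : Multiset (Clause N K)) :
    multisetMax (c ::ₘ L) =
      multisetMax L + if ∃ x ∈ optimal L, SatClause x c then 1 else 0 := by
  apply le_antisymm
  · obtain ⟨x, hx⟩ := exists_countP_eq_multisetMax (c ::ₘ L)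
    rw [← hx, Multiset.countP_cons]
    have hle := countP_le_multisetMax L x
    by_cases hs : SatClause x c
    · by_cases ho : x ∈ optimal L
      · rw [if_pos hs, if_pos ⟨x, ho, hs⟩]
        lia
      · have : L.countP (SatClause x) ≠ multisetMax L := ho
        rw [if_pos hs]
        lia
    · rw [if_neg hs]
      lia
  · split_ifs with h
    · obtain ⟨x, ho, hs⟩ := h
      have ho : L.countP (SatClause x) = multisetMax L := ho
      have := countP_le_multisetMax (c ::ₘ L) x
      rw [Multiset.countP_cons, if_pos hs] at this
      lia
    · obtain ⟨x, hx⟩ := exists_countP_eq_multisetMax L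
      have := countP_le_multisetMax (c ::ₘ L) x
      rw [Multiset.countP_cons] at this
      lia

theorem unitIncrements_multisetMax :
    UnitIncrements (fun L : Multiset (Clause N K) => (multisetMax L : ℝ)) := by
  intro c L
  simp only [multisetMax_cons]
  split_ifs <;> simp

/-- Relabelling of the variables of a clause. -/
def mapClause (e : Fin N' → Fin N) (c : Clause N' K) : Clause N K := (e ∘ c.1, c.2)

/-- The literals whose value agrees on all assignments in `O`, among the variables in the range
of `e`. -/
noncomputable def forcedLiterals (O : Set (Fin N → Bool)) (e : Fin N' → Fin N) :
    Finset (Fin N' × Bool) :=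
  Finset.univ.filter fun p => ∀ x ∈ O, x (e p.1) = p.2

theorem card_violated (O : Set (Fin N → Bool)) (e : Fin N' → Fin N) :
    (Finset.univ.filter fun c : Clause N' K => ∀ x ∈ O, ¬ SatClause x (mapClause e c)).card =
      (forcedLiterals O e).card ^ K := by
  have key (c : Clause N' K) : (∀ x ∈ O, ¬ SatClause x (mapClause e c)) ↔
      ∀ k, (c.1 k, c.2 k) ∈ forcedLiterals O e := by
    simp only [SatClause, mapClause, forcedLiterals, Finset.mem_filter, Finset.mem_univ,
      true_and, not_not, funext_iff, Function.comp_apply]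
    exact ⟨fun h k x hx => h x hx k, fun h x hx k => h k x hx⟩
  have equiv : {c : Clause N' K // ∀ x ∈ O, ¬ SatClause x (mapClause e c)} ≃
      (Fin K → forcedLiterals O e) :=
    { toFun := fun c k => ⟨(c.1.1 k, c.1.2 k), (key c.1).1 c.2 k⟩
      invFun := fun f => ⟨(fun k => (f k).1.1, fun k => (f k).1.2),
        (key _).2 fun k => (f k).2⟩
      left_inv := fun _ => rfl
      right_inv := fun _ => rfl }
  rw [← Fintype.card_subtype, Fintype.card_congr equiv]
  simp

theorem avgOp_multisetMax (hN' : 0 < N') (e : Fin N' → Fin N) (L : Multiset (Clause N K)) :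
    avgOp (mapClause e) (fun L : Multiset (Clause N K) => (multisetMax L : ℝ)) L =
      multisetMax L + 1 - ((forcedLiterals (optimal L) e).card / (2 * N' : ℝ)) ^ K := by
  have hn : (0 : ℝ) < N' := by exact_mod_cast hN'
  have hcard : (Fintype.card (Clause N' K) : ℝ) = (2 * N' : ℝ) ^ K := by
    simp [mul_pow, mul_comm]
  have hterm (c : Clause N' K) : (multisetMax (mapClause e c ::ₘ L) : ℝ) =
      multisetMax L + 1 -
        if ∀ x ∈ optimal L, ¬ SatClause x (mapClause e c) then 1 else 0 := by
    rw [multisetMax_cons]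
    by_cases h : ∃ x ∈ optimal L, SatClause x (mapClause e c)
    · have h' : ¬ ∀ x ∈ optimal L, ¬ SatClause x (mapClause e c) := by
        push Not
        exact h
      rw [if_pos h, if_neg h']
      simp
    · have h' : ∀ x ∈ optimal L, ¬ SatClause x (mapClause e c) := by
        push Not at h
        exact h
      rw [if_neg h, if_pos h']
      simp
  rw [avgOp_apply]
  simp only [hterm, Finset.sum_sub_distrib, Finset.sum_boole, card_violated, Finset.sum_const,
    Finset.card_univ, nsmul_eq_mul, hcard, Nat.cast_pow, div_pow]
  have : (2 * N' : ℝ) ^ K ≠ 0 := by positivity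
  field_simp

theorem card_forcedLiterals_add (N₁ N₂ : ℕ) (O : Set (Fin (N₁ + N₂) → Bool)) :
    (forcedLiterals O id).card =
      (forcedLiterals O (Fin.castAdd N₂)).card + (forcedLiterals O (Fin.natAdd N₁)).card := by
  simp only [forcedLiterals, Finset.card_filter, Fintype.sum_prod_type, Fin.sum_univ_add, id]

/-- One step of the interpolation: a clause on all variables is on average at least as likely
to be satisfiable in addition as a clause confined to a random block. -/
theorem avgOp_blocks_le {N₁ N₂ : ℕ} (h₁ : 0 < N₁) (h₂ : 0 < N₂) :
    ((N₁ : ℝ) • avgOp (mapClause (K := K) (Fin.castAdd N₂)) +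
        (N₂ : ℝ) • avgOp (mapClause (K := K) (Fin.natAdd N₁)) :
          Module.End ℝ (Multiset (Clause (N₁ + N₂) K) → ℝ))
          (fun L => (multisetMax L : ℝ)) ≤
      ((N₁ + N₂ : ℕ) : ℝ) • avgOp (id : Clause (N₁ + N₂) K → _)
        (fun L => (multisetMax L : ℝ)) := by
  intro L
  have hid : (id : Clause (N₁ + N₂) K → Clause (N₁ + N₂) K) = mapClause id := rfl
  have hr₁ : (0 : ℝ) < N₁ := by exact_mod_cast h₁
  have hr₂ : (0 : ℝ) < N₂ := by exact_mod_cast h₂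
  have hr : (0 : ℝ) < N₁ + N₂ := by positivity
  rw [hid]
  simp only [LinearMap.add_apply, LinearMap.smul_apply, Pi.add_apply, Pi.smul_apply, smul_eq_mul,
    avgOp_multisetMax h₁, avgOp_multisetMax h₂, avgOp_multisetMax (Nat.add_pos_left h₁ N₂),
    card_forcedLiterals_add]
  push_cast
  set z₁ : ℝ := ((forcedLiterals (optimal L) (Fin.castAdd N₂)).card : ℝ)
  set z₂ : ℝ := ((forcedLiterals (optimal L) (Fin.natAdd N₁)).card : ℝ)
  have hz₁ : 0 ≤ z₁ / (2 * N₁) := by positivity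
  have hz₂ : 0 ≤ z₂ / (2 * N₂) := by positivity
  have ha : (0 : ℝ) ≤ N₁ / (N₁ + N₂) := by positivity
  have hb : (0 : ℝ) ≤ N₂ / (N₁ + N₂) := by positivity
  have hab : (N₁ : ℝ) / (N₁ + N₂) + N₂ / (N₁ + N₂) = 1 := by field_simp
  have hconv := (convexOn_pow (𝕜 := ℝ) K).2 hz₁ hz₂ ha hb hab
  simp only [smul_eq_mul] at hconv
  have harg : (N₁ : ℝ) / (N₁ + N₂) * (z₁ / (2 * N₁)) + N₂ / (N₁ + N₂) * (z₂ / (2 * N₂)) =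
      (z₁ + z₂) / (2 * (N₁ + N₂)) := by
    field_simp
  rw [harg] at hconv
  have := mul_le_mul_of_nonneg_left hconv hr.le
  have hrhs : ((N₁ : ℝ) + N₂) * (N₁ / (N₁ + N₂) * (z₁ / (2 * N₁)) ^ K +
      N₂ / (N₁ + N₂) * (z₂ / (2 * N₂)) ^ K) =
      N₁ * (z₁ / (2 * N₁)) ^ K + N₂ * (z₂ / (2 * N₂)) ^ K := by
    field_simp
  rw [hrhs] at this
  linarith

theorem multisetMax_add_le {N₁ N₂ : ℕ} (L₁ : Multiset (Clause N₁ K))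
    (L₂ : Multiset (Clause N₂ K)) :
    multisetMax L₁ + multisetMax L₂ ≤
      multisetMax (L₁.map (mapClause (Fin.castAdd N₂)) +
        L₂.map (mapClause (Fin.natAdd N₁))) := by
  obtain ⟨x₁, hx₁⟩ := exists_countP_eq_multisetMax L₁
  obtain ⟨x₂, hx₂⟩ := exists_countP_eq_multisetMax L₂
  refine le_trans (le_of_eq ?_) (countP_le_multisetMax _ (Fin.append x₁ x₂))
  rw [← hx₁, ← hx₂, Multiset.countP_add, Multiset.countP_map, Multiset.countP_map,
    Multiset.countP_eq_card_filter, Multiset.countP_eq_card_filter]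
  have left (c : Clause N₁ K) :
      SatClause (Fin.append x₁ x₂) (mapClause (Fin.castAdd N₂) c) ↔ SatClause x₁ c := by
    simp [SatClause, mapClause]
  have right (c : Clause N₂ K) :
      SatClause (Fin.append x₁ x₂) (mapClause (Fin.natAdd N₁) c) ↔ SatClause x₂ c := by
    simp [SatClause, mapClause]
  simp only [left, right]

end MultisetMax

section Expectation

variable {K : ℕ}

/-- The expected maximum number of satisfiable clauses of an instance with `N` variables and
`M` clauses. -/
noncomputable def expectedMax (K N M : ℕ) : ℝ :=
  (avgOp (id : Clause N K → Clause N K) ^ M) (fun L => (multisetMax L : ℝ)) 0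

theorem expectedMax_zero (N : ℕ) : expectedMax K N 0 = 0 := by
  simp [expectedMax, multisetMax_zero]

theorem expectedMax_succ {N : ℕ} [NeZero N] (M : ℕ) :
    expectedMax K N M ≤ expectedMax K N (M + 1) ∧
      expectedMax K N (M + 1) ≤ expectedMax K N M + 1 :=
  unitIncrements_multisetMax.avgOp_pow_succ id M 0

theorem abs_expectedMax_sub_le {N : ℕ} [NeZero N] (M M' : ℕ) :
    |expectedMax K N M - expectedMax K N M'| ≤ |(M : ℝ) - M'| := by
  wlog h : M' ≤ M generalizing M M'
  · rw [abs_sub_comm, abs_sub_comm (M : ℝ)]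
    exact this _ _ (le_of_not_ge h)
  obtain ⟨d, rfl⟩ := Nat.exists_eq_add_of_le h
  have key : expectedMax K N M' ≤ expectedMax K N (M' + d) ∧
      expectedMax K N (M' + d) ≤ expectedMax K N M' + d := by
    clear h
    induction d with
    | zero => simp
    | succ d ih =>
      have := expectedMax_succ (K := K) (N := N) (M' + d)
      rw [← add_assoc]
      push_cast
      constructor <;> linarith
  rw [abs_of_nonneg (by linarith)]
  push_cast
  rw [add_sub_cancel_left, abs_of_nonneg (by positivity)]
  linarith

theorem expectedMax_nonneg {N : ℕ} [NeZero N] (M : ℕ) : 0 ≤ expectedMax K N M := by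
  induction M with
  | zero => rw [expectedMax_zero]
  | succ M ih => exact ih.trans (expectedMax_succ M).1

theorem expectedMax_le {N : ℕ} [NeZero N] (M : ℕ) : expectedMax K N M ≤ M := by
  have := (le_abs_self _).trans (abs_expectedMax_sub_le (K := K) (N := N) M 0)
  simpa [expectedMax_zero] using this

theorem le_avgOp_block_left {N₁ N₂ : ℕ} [NeZero N₁]
    {f : Multiset (Clause (N₁ + N₂) K) → ℝ} {g₁ : Multiset (Clause N₁ K) → ℝ}
    {g₂ : Multiset (Clause N₂ K) → ℝ}
    (h : ∀ L₁ L₂, g₁ L₁ + g₂ L₂ ≤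
      f (L₁.map (mapClause (Fin.castAdd N₂)) + L₂.map (mapClause (Fin.natAdd N₁))))
    (L₁ : Multiset (Clause N₁ K)) (L₂ : Multiset (Clause N₂ K)) :
    avgOp id g₁ L₁ + g₂ L₂ ≤ avgOp (mapClause (Fin.castAdd N₂)) f
      (L₁.map (mapClause (Fin.castAdd N₂)) + L₂.map (mapClause (Fin.natAdd N₁))) := by
  have hc : (0 : ℝ) < Fintype.card (Clause N₁ K) := by exact_mod_cast Fintype.card_pos
  rw [avgOp_apply, avgOp_apply, div_add' _ _ _ hc.ne']
  gcongr
  calc ∑ a, g₁ (id a ::ₘ L₁) + g₂ L₂ * Fintype.card (Clause N₁ K)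
      = ∑ a, (g₁ (a ::ₘ L₁) + g₂ L₂) := by
        rw [Finset.sum_add_distrib, Finset.sum_const, Finset.card_univ, nsmul_eq_mul,
          mul_comm (g₂ L₂)]
        rfl
    _ ≤ _ := Finset.sum_le_sum fun a _ => by
        simpa using h (a ::ₘ L₁) L₂

theorem le_avgOp_block_right {N₁ N₂ : ℕ} [NeZero N₂]
    {f : Multiset (Clause (N₁ + N₂) K) → ℝ} {g₁ : Multiset (Clause N₁ K) → ℝ}
    {g₂ : Multiset (Clause N₂ K) → ℝ}
    (h : ∀ L₁ L₂, g₁ L₁ + g₂ L₂ ≤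
      f (L₁.map (mapClause (Fin.castAdd N₂)) + L₂.map (mapClause (Fin.natAdd N₁))))
    (L₁ : Multiset (Clause N₁ K)) (L₂ : Multiset (Clause N₂ K)) :
    g₁ L₁ + avgOp id g₂ L₂ ≤ avgOp (mapClause (Fin.natAdd N₁)) f
      (L₁.map (mapClause (Fin.castAdd N₂)) + L₂.map (mapClause (Fin.natAdd N₁))) := by
  have hc : (0 : ℝ) < Fintype.card (Clause N₂ K) := by exact_mod_cast Fintype.card_pos
  rw [avgOp_apply, avgOp_apply, add_div' _ _ _ hc.ne']
  gcongr
  calc g₁ L₁ * Fintype.card (Clause N₂ K) + ∑ a, g₂ (id a ::ₘ L₂)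
      = ∑ a, (g₁ L₁ + g₂ (a ::ₘ L₂)) := by
        rw [Finset.sum_add_distrib, Finset.sum_const, Finset.card_univ, nsmul_eq_mul,
          mul_comm (g₁ L₁)]
        rfl
    _ ≤ _ := Finset.sum_le_sum fun a _ => by
        simpa using h L₁ (a ::ₘ L₂)

theorem expectedMax_add_le_blocks {N₁ N₂ : ℕ} [NeZero N₁] [NeZero N₂] (B₁ B₂ : ℕ) :
    expectedMax K N₁ B₁ + expectedMax K N₂ B₂ ≤
      (avgOp (mapClause (K := K) (Fin.castAdd N₂)) ^ B₁ *
        avgOp (mapClause (K := K) (Fin.natAdd N₁)) ^ B₂ :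
          Module.End ℝ (Multiset (Clause (N₁ + N₂) K) → ℝ)) (fun L => (multisetMax L : ℝ)) 0 := by
  have hright : ∀ L₁ L₂, (multisetMax L₁ : ℝ) +
      (avgOp (id : Clause N₂ K → _) ^ B₂) (fun L => (multisetMax L : ℝ)) L₂ ≤
      (avgOp (mapClause (K := K) (Fin.natAdd N₁)) ^ B₂) (fun L => (multisetMax L : ℝ))
        (L₁.map (mapClause (Fin.castAdd N₂)) + L₂.map (mapClause (Fin.natAdd N₁))) := by
    induction B₂ with
    | zero =>
      intro L₁ L₂
      simpa using (by exact_mod_cast multisetMax_add_le L₁ L₂ :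
        (multisetMax L₁ : ℝ) + multisetMax L₂ ≤ _)
    | succ B₂ ih =>
      rw [pow_succ', pow_succ']
      exact le_avgOp_block_right (g₁ := fun L => (multisetMax L : ℝ)) ih
  have hleft : ∀ L₁ L₂, (avgOp (id : Clause N₁ K → _) ^ B₁) (fun L => (multisetMax L : ℝ)) L₁ +
      (avgOp (id : Clause N₂ K → _) ^ B₂) (fun L => (multisetMax L : ℝ)) L₂ ≤
      (avgOp (mapClause (K := K) (Fin.castAdd N₂)) ^ B₁ *
        avgOp (mapClause (K := K) (Fin.natAdd N₁)) ^ B₂ :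
          Module.End ℝ (Multiset (Clause (N₁ + N₂) K) → ℝ)) (fun L => (multisetMax L : ℝ))
        (L₁.map (mapClause (Fin.castAdd N₂)) + L₂.map (mapClause (Fin.natAdd N₁))) := by
    induction B₁ with
    | zero => simpa using hright
    | succ B₁ ih =>
      rw [pow_succ', pow_succ', mul_assoc]
      exact le_avgOp_block_left ih
  simpa [expectedMax] using hleft 0 0

/-- Discrete interpolation inequality, multiplied by `(N₁ + N₂) ^ M`. -/
theorem sum_antidiagonal_expectedMax_le {N₁ N₂ : ℕ} [NeZero N₁] [NeZero N₂] (M : ℕ) :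
    ∑ B ∈ Finset.HasAntidiagonal.antidiagonal M, (M.choose B.1 : ℝ) * ((N₁ : ℝ) ^ B.1 * (N₂ : ℝ) ^ B.2) *
        (expectedMax K N₁ B.1 + expectedMax K N₂ B.2) ≤
      ((N₁ + N₂ : ℕ) : ℝ) ^ M * expectedMax K (N₁ + N₂) M := by
  set T := avgOp (id : Clause (N₁ + N₂) K → Clause (N₁ + N₂) K) with hT
  set T₁ := avgOp (mapClause (K := K) (Fin.castAdd (n := N₁) N₂)) with hT₁
  set T₂ := avgOp (mapClause (K := K) (Fin.natAdd (m := N₂) N₁)) with hT₂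
  set h : Multiset (Clause (N₁ + N₂) K) → ℝ := fun L => (multisetMax L : ℝ) with hh
  set S := (N₁ : ℝ) • T₁ + (N₂ : ℝ) • T₂ with hS
  set n : ℝ := ((N₁ + N₂ : ℕ) : ℝ) with hn
  have hn0 : 0 ≤ n := by positivity
  have hST : S h ≤ n • T h :=
    avgOp_blocks_le (Nat.pos_of_ne_zero (NeZero.ne _)) (Nat.pos_of_ne_zero (NeZero.ne _))
  have hcomm : Commute S T :=
    ((avgOp_commute _ _).smul_left _).add_left ((avgOp_commute _ _).smul_left _)
  have hSmono {f f' : Multiset (Clause (N₁ + N₂) K) → ℝ} (hf : f ≤ f') : S f ≤ S f' := by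
    intro L
    simp only [hS, LinearMap.add_apply, LinearMap.smul_apply, Pi.add_apply, Pi.smul_apply,
      smul_eq_mul]
    have a₁ := avgOp_mono (mapClause (K := K) (Fin.castAdd (n := N₁) N₂)) hf L
    have a₂ := avgOp_mono (mapClause (K := K) (Fin.natAdd (m := N₂) N₁)) hf L
    gcongr
  have hinterp : (S ^ M) h ≤ n ^ M • (T ^ M) h := by
    induction M with
    | zero => simp
    | succ M ih =>
      have e₁ : S (n ^ M • (T ^ M) h) = n ^ M • (T ^ M) (S h) := by
        rw [map_smul, ← Module.End.mul_apply, (hcomm.pow_right M).eq, Module.End.mul_apply]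
      calc (S ^ (M + 1)) h = S ((S ^ M) h) := by rw [pow_succ', Module.End.mul_apply]
        _ ≤ S (n ^ M • (T ^ M) h) := hSmono ih
        _ = n ^ M • (T ^ M) (S h) := e₁
        _ ≤ n ^ M • (T ^ M) (n • T h) :=
          smul_le_smul_of_nonneg_left (avgOp_pow_mono _ M hST) (by positivity)
        _ = n ^ (M + 1) • (T ^ (M + 1)) h := by
          rw [map_smul, smul_smul, ← pow_succ, pow_succ T, Module.End.mul_apply]
  have hbinom : S ^ M = ∑ B ∈ Finset.HasAntidiagonal.antidiagonal M,
      ((M.choose B.1 : ℝ) * ((N₁ : ℝ) ^ B.1 * (N₂ : ℝ) ^ B.2)) • (T₁ ^ B.1 * T₂ ^ B.2) := by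
    rw [hS, (((avgOp_commute _ _).smul_left _).smul_right _ :
      Commute ((N₁ : ℝ) • T₁) ((N₂ : ℝ) • T₂)).add_pow']
    refine Finset.sum_congr rfl fun B _ => ?_
    rw [smul_pow, smul_pow, smul_mul_smul_comm, ← Nat.cast_smul_eq_nsmul ℝ, smul_smul]
  have := hinterp 0
  rw [hbinom] at this
  simp only [LinearMap.sum_apply, LinearMap.smul_apply, Finset.sum_apply, Pi.smul_apply,
    smul_eq_mul] at this
  refine le_trans (Finset.sum_le_sum fun B _ => ?_) this
  gcongr
  exact expectedMax_add_le_blocks B.1 B.2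

end Expectation

section Poisson

/-- The Poisson weight. -/
noncomputable def poissonWeight (r : ℝ) (n : ℕ) : ℝ := Real.exp (-r) * r ^ n / n.factorial

theorem poissonWeight_nonneg {r : ℝ} (hr : 0 ≤ r) (n : ℕ) : 0 ≤ poissonWeight r n := by
  unfold poissonWeight
  positivity

theorem hasSum_poissonWeight {r : ℝ} (hr : 0 ≤ r) : HasSum (poissonWeight r) 1 :=
  ProbabilityTheory.hasSum_one_poissonMeasure ⟨r, hr⟩

theorem poissonWeight_succ_mul (r : ℝ) (n : ℕ) :
    poissonWeight r (n + 1) * (n + 1 : ℕ) = r * poissonWeight r n := by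
  unfold poissonWeight
  rw [Nat.factorial_succ, pow_succ]
  push_cast
  field_simp

theorem hasSum_poissonWeight_mul {r : ℝ} (hr : 0 ≤ r) :
    HasSum (fun n => poissonWeight r n * n) r := by
  rw [← hasSum_nat_add_iff' 1]
  simp only [poissonWeight_succ_mul]
  simpa using (hasSum_poissonWeight hr).mul_left r

theorem hasSum_poissonWeight_mul_sq {r : ℝ} (hr : 0 ≤ r) :
    HasSum (fun n => poissonWeight r n * (n : ℝ) ^ 2) (r * (r + 1)) := by
  rw [← hasSum_nat_add_iff' 1]
  have h (n : ℕ) : poissonWeight r (n + 1) * ((n + 1 : ℕ) : ℝ) ^ 2 =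
      r * (poissonWeight r n * n + poissonWeight r n) := by
    rw [sq, ← mul_assoc, poissonWeight_succ_mul]
    push_cast
    ring
  simp only [h]
  simpa using ((hasSum_poissonWeight_mul hr).add (hasSum_poissonWeight hr)).mul_left r

theorem hasSum_poissonWeight_mul_sub_sq {r : ℝ} (hr : 0 ≤ r) :
    HasSum (fun n => poissonWeight r n * ((n : ℝ) - r) ^ 2) r := by
  have h := ((hasSum_poissonWeight_mul_sq hr).sub
    ((hasSum_poissonWeight_mul hr).mul_left (2 * r))).add
    ((hasSum_poissonWeight hr).mul_left (r ^ 2))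
  have hval : r * (r + 1) - 2 * r * r + r ^ 2 * 1 = r := by ring
  rw [hval] at h
  exact h.congr_fun fun n => by ring

/-- The convolution of two Poisson weights, before summation over the antidiagonal. -/
theorem poissonWeight_mul_poissonWeight (c a b : ℝ) (i j : ℕ) :
    poissonWeight (c * a) i * poissonWeight (c * b) j =
      Real.exp (-(c * (a + b))) * c ^ (i + j) / (i + j).factorial *
        (((i + j).choose i : ℝ) * (a ^ i * b ^ j)) := by
  have h : ((i + j).choose i : ℝ) * (i.factorial * j.factorial) = (i + j).factorial := by
    rw [← mul_assoc]
    exact_mod_cast Nat.choose_symm_add ▸ Nat.add_choose_mul_factorial_mul_factorial i j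
  have hc : ((i + j).choose i : ℝ) = (i + j).factorial / (i.factorial * j.factorial) := by
    rw [← h]
    field_simp
  have he : Real.exp (-(c * (a + b))) = Real.exp (-(c * a)) * Real.exp (-(c * b)) := by
    rw [← Real.exp_add]
    ring_nf
  unfold poissonWeight
  rw [hc, he, mul_pow, mul_pow, pow_add]
  field_simp

end Poisson

section Limit

variable {K : ℕ} {c : ℝ}

/-- The expected maximum number of satisfiable clauses with a Poisson number of clauses. -/
noncomputable def poissonMax (K : ℕ) (c : ℝ) (N : ℕ) : ℝ :=
  ∑' M, poissonWeight (c * N) M * expectedMax K N M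

theorem summable_poissonMax (hc : 0 < c) (N : ℕ) [NeZero N] :
    Summable fun M => poissonWeight (c * N) M * expectedMax K N M := by
  have hr : 0 ≤ c * N := by positivity
  refine (hasSum_poissonWeight_mul hr).summable.of_nonneg_of_le (fun M => ?_) (fun M => ?_)
  · exact mul_nonneg (poissonWeight_nonneg hr M) (expectedMax_nonneg M)
  · exact mul_le_mul_of_nonneg_left (expectedMax_le M) (poissonWeight_nonneg hr M)

theorem poissonMax_zero : poissonMax K c 0 = 0 := by
  rw [poissonMax, tsum_eq_single 0]
  · simp [expectedMax_zero]
  · intro M hM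
    simp [poissonWeight, hM]

theorem poissonMax_le (hc : 0 < c) (N : ℕ) [NeZero N] : poissonMax K c N ≤ c * N := by
  have hr : 0 ≤ c * N := by positivity
  exact hasSum_le
    (fun M => mul_le_mul_of_nonneg_left (expectedMax_le M) (poissonWeight_nonneg hr M))
    (summable_poissonMax hc N).hasSum (hasSum_poissonWeight_mul hr)

theorem poissonMax_add_le (hc : 0 < c) (N₁ N₂ : ℕ) [NeZero N₁] [NeZero N₂] :
    poissonMax K c N₁ + poissonMax K c N₂ ≤ poissonMax K c (N₁ + N₂) := by
  have hr₁ : 0 ≤ c * N₁ := by positivity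
  have hr₂ : 0 ≤ c * N₂ := by positivity
  set w₁ := poissonWeight (c * N₁)
  set w₂ := poissonWeight (c * N₂)
  have hw₁ : Summable fun M => ‖w₁ M‖ := (hasSum_poissonWeight hr₁).summable.norm
  have hw₂ : Summable fun M => ‖w₂ M‖ := (hasSum_poissonWeight hr₂).summable.norm
  have hf₁ : Summable fun M => ‖w₁ M * expectedMax K N₁ M‖ := (summable_poissonMax hc N₁).norm
  have hf₂ : Summable fun M => ‖w₂ M * expectedMax K N₂ M‖ := (summable_poissonMax hc N₂).norm
  have e₁ : poissonMax K c N₁ = ∑' M, ∑ B ∈ Finset.HasAntidiagonal.antidiagonal M,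
      w₁ B.1 * expectedMax K N₁ B.1 * w₂ B.2 := by
    rw [← tsum_mul_tsum_eq_tsum_sum_antidiagonal_of_summable_norm hf₁ hw₂,
      (hasSum_poissonWeight hr₂).tsum_eq, mul_one]
    rfl
  have e₂ : poissonMax K c N₂ = ∑' M, ∑ B ∈ Finset.HasAntidiagonal.antidiagonal M,
      w₁ B.1 * (w₂ B.2 * expectedMax K N₂ B.2) := by
    rw [← tsum_mul_tsum_eq_tsum_sum_antidiagonal_of_summable_norm hw₁ hf₂,
      (hasSum_poissonWeight hr₁).tsum_eq, one_mul]
    rfl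
  have s₁ := (summable_norm_sum_mul_antidiagonal_of_summable_norm hf₁ hw₂).of_norm
  have s₂ := (summable_norm_sum_mul_antidiagonal_of_summable_norm hw₁ hf₂).of_norm
  rw [e₁, e₂, ← s₁.tsum_add s₂]
  refine (s₁.add s₂).tsum_le_tsum (fun M => ?_) (summable_poissonMax hc (N₁ + N₂))
  rw [← Finset.sum_add_distrib]
  set r : ℝ := Real.exp (-(c * ((N₁ : ℝ) + N₂))) * c ^ M / M.factorial with hr
  have hr0 : 0 ≤ r := by positivity
  calc ∑ B ∈ Finset.HasAntidiagonal.antidiagonal M,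
        (w₁ B.1 * expectedMax K N₁ B.1 * w₂ B.2 + w₁ B.1 * (w₂ B.2 * expectedMax K N₂ B.2))
      = ∑ B ∈ Finset.HasAntidiagonal.antidiagonal M,
          r * ((M.choose B.1 : ℝ) * ((N₁ : ℝ) ^ B.1 * (N₂ : ℝ) ^ B.2) *
            (expectedMax K N₁ B.1 + expectedMax K N₂ B.2)) := by
        refine Finset.sum_congr rfl fun B hB => ?_
        obtain rfl := Finset.HasAntidiagonal.mem_antidiagonal.1 hB
        have := poissonWeight_mul_poissonWeight c N₁ N₂ B.1 B.2
        rw [hr, ← mul_assoc (Real.exp _ * _ / _), ← this]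
        ring
    _ ≤ r * (((N₁ + N₂ : ℕ) : ℝ) ^ M * expectedMax K (N₁ + N₂) M) := by
        rw [← Finset.mul_sum]
        exact mul_le_mul_of_nonneg_left (sum_antidiagonal_expectedMax_le M) hr0
    _ = _ := by
        rw [hr, poissonWeight, mul_pow]
        push_cast
        ring

theorem exists_tendsto_poissonMax_div (hc : 0 < c) :
    ∃ H : ℝ, Tendsto (fun N : ℕ => poissonMax K c N / N) atTop (nhds H) := by
  have hsub : Subadditive fun N => -poissonMax K c N := by
    intro m n
    rcases Nat.eq_zero_or_pos m with rfl | hm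
    · simp [poissonMax_zero]
    rcases Nat.eq_zero_or_pos n with rfl | hn
    · simp [poissonMax_zero]
    have : NeZero m := ⟨hm.ne'⟩
    have : NeZero n := ⟨hn.ne'⟩
    have := poissonMax_add_le (K := K) hc m n
    linarith
  have hbdd : BddBelow (Set.range fun N : ℕ => -poissonMax K c N / N) := by
    refine ⟨-c, ?_⟩
    rintro _ ⟨N, rfl⟩
    rcases Nat.eq_zero_or_pos N with rfl | hN
    · simpa using hc.le
    have : NeZero N := ⟨hN.ne'⟩
    have hN' : (0 : ℝ) < N := by exact_mod_cast hN
    have := poissonMax_le (K := K) hc N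
    simp only
    rw [le_div_iff₀ hN']
    linarith
  refine ⟨-hsub.lim, ?_⟩
  simpa [neg_div] using (hsub.tendsto_lim hbdd).neg

theorem abs_poissonMax_sub_expectedMax_le (hc : 0 < c) (N : ℕ) [NeZero N] :
    |poissonMax K c N - expectedMax K N ⌊c * (N : ℝ)⌋₊| ≤ √(c * N) + 1 := by
  have hN : (0 : ℝ) < N := by exact_mod_cast Nat.pos_of_ne_zero (NeZero.ne N)
  set r := c * (N : ℝ) with hr
  have hr0 : 0 < r := by positivity
  set s := √r with hs
  have hs0 : 0 < s := Real.sqrt_pos.2 hr0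
  have hss : s * s = r := Real.mul_self_sqrt hr0.le
  set m := ⌊r⌋₊
  have hm : |r - m| ≤ 1 := by
    rw [abs_le]
    have h₁ := Nat.floor_le hr0.le
    have h₂ := Nat.lt_floor_add_one r
    constructor <;> linarith
  have hdiff := (summable_poissonMax (K := K) hc N).hasSum.sub
    ((hasSum_poissonWeight hr0.le).mul_right (expectedMax K N m))
  have hbound := ((hasSum_poissonWeight_mul_sub_sq hr0.le).mul_left (1 / (2 * s))).add
    ((hasSum_poissonWeight hr0.le).mul_left (s / 2 + 1))
  rw [one_mul] at hdiff
  have hval : 1 / (2 * s) * r + (s / 2 + 1) * 1 = s + 1 := by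
    rw [← hss]
    field_simp
    ring
  rw [hval] at hbound
  rw [← Real.norm_eq_abs, poissonMax, ← hdiff.tsum_eq]
  refine tsum_of_norm_bounded hbound fun M => ?_
  have hw := poissonWeight_nonneg hr0.le M
  have h₁ : |(M : ℝ) - r| ≤ 1 / (2 * s) * ((M : ℝ) - r) ^ 2 + s / 2 := by
    rw [← sq_abs]
    have : 0 ≤ (|(M : ℝ) - r| - s) ^ 2 / (2 * s) := by positivity
    have e : (|(M : ℝ) - r| - s) ^ 2 / (2 * s) =
        1 / (2 * s) * |(M : ℝ) - r| ^ 2 + s / 2 - |(M : ℝ) - r| := by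
      field_simp
      ring
    linarith
  have h₂ : |expectedMax K N M - expectedMax K N m| ≤
      1 / (2 * s) * ((M : ℝ) - r) ^ 2 + (s / 2 + 1) := by
    have := abs_expectedMax_sub_le (K := K) (N := N) M m
    have := abs_sub_le (M : ℝ) r m
    linarith
  rw [← hr, ← mul_sub, Real.norm_eq_abs, abs_mul, abs_of_nonneg hw]
  calc poissonWeight r M * |expectedMax K N M - expectedMax K N m|
      ≤ poissonWeight r M * (1 / (2 * s) * ((M : ℝ) - r) ^ 2 + (s / 2 + 1)) := by gcongr
    _ = _ := by ring

theorem exists_tendsto_expectedMax_div (K : ℕ) (hc : 0 < c) :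
    ∃ H : ℝ, Tendsto (fun N : ℕ => expectedMax K N ⌊c * (N : ℝ)⌋₊ / N) atTop (nhds H) := by
  obtain ⟨H, hH⟩ := exists_tendsto_poissonMax_div (K := K) hc
  refine ⟨H, ?_⟩
  have hz : Tendsto (fun N : ℕ => √c / √(N : ℝ) + 1 / (N : ℝ)) atTop (nhds 0) := by
    have h₁ : Tendsto (fun N : ℕ => √c / √(N : ℝ)) atTop (nhds 0) :=
      tendsto_const_nhds.div_atTop
        (Real.tendsto_sqrt_atTop.comp tendsto_natCast_atTop_atTop)
    simpa using h₁.add tendsto_one_div_atTop_nhds_zero_nat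
  have hd : Tendsto (fun N : ℕ => poissonMax K c N / N - expectedMax K N ⌊c * (N : ℝ)⌋₊ / N)
      atTop (nhds 0) := by
    refine squeeze_zero_norm' ?_ hz
    filter_upwards [eventually_gt_atTop 0] with N hN
    have : NeZero N := ⟨hN.ne'⟩
    have hN' : (0 : ℝ) < N := by exact_mod_cast hN
    rw [← sub_div, Real.norm_eq_abs, abs_div, abs_of_pos hN', div_le_iff₀ hN']
    refine (abs_poissonMax_sub_expectedMax_le hc N).trans (le_of_eq ?_)
    have hsq : √(N : ℝ) * √(N : ℝ) = N := Real.mul_self_sqrt hN'.le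
    have : √(N : ℝ) ≠ 0 := (Real.sqrt_pos.2 hN').ne'
    rw [Real.sqrt_mul hc.le, add_mul, one_div_mul_cancel hN'.ne', div_mul_eq_mul_div]
    congr 1
    rw [eq_div_iff this, mul_assoc, hsq]
  simpa using hH.sub hd

end Limit

section Concentration

variable {N K M : ℕ}

theorem ksatMax_eq_multisetMax (C : Fin M → Clause N K) :
    ksatMax C = multisetMax (Finset.univ.val.map C) := by
  unfold ksatMax multisetMax
  congr 1
  funext x
  rw [Multiset.countP_map, Finset.card_def, Finset.filter_val]
  exact congrArg Multiset.card (Multiset.filter_congr fun _ _ => Iff.rfl)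

theorem expectedMax_eq_sum :
    expectedMax K N M =
      (∑ C : Fin M → Clause N K, (ksatMax C : ℝ)) / Fintype.card (Fin M → Clause N K) := by
  rw [expectedMax, avgOp_pow_eq_sum_pi]
  simp only [ksatMax_eq_multisetMax, add_zero, id]

theorem sum_sub_expectedMax_sq_le [NeZero N] :
    ∑ C : Fin M → Clause N K, ((ksatMax C : ℝ) - expectedMax K N M) ^ 2 ≤
      M * Fintype.card (Fin M → Clause N K) := by
  have hc : (0 : ℝ) < Fintype.card (Fin M → Clause N K) := by exact_mod_cast Fintype.card_pos
  have h := (unitIncrements_multisetMax (N := N) (K := K)).avgOp_pow_sq_le id M 0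
  have hsum : ∑ C : Fin M → Clause N K, (ksatMax C : ℝ) =
      expectedMax K N M * Fintype.card (Fin M → Clause N K) := by
    rw [expectedMax_eq_sum]
    field_simp
  have hsq : ∑ C : Fin M → Clause N K, (ksatMax C : ℝ) ^ 2 ≤
      (expectedMax K N M ^ 2 + M) * Fintype.card (Fin M → Clause N K) := by
    rw [← div_le_iff₀ hc]
    refine le_trans (le_of_eq ?_) h
    rw [avgOp_pow_eq_sum_pi]
    simp only [ksatMax_eq_multisetMax, add_zero, id]
  simp only [sub_sq, Finset.sum_add_distrib, Finset.sum_sub_distrib, ← Finset.sum_mul,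
    ← Finset.mul_sum, hsum, Finset.sum_const, Finset.card_univ, nsmul_eq_mul]
  linarith

/-- Chebyshev's inequality for the maximum number of satisfiable clauses. -/
theorem probKSAT_abs_sub_expectedMax_le [NeZero N] {δ : ℝ} (hδ : 0 < δ) :
    probKSAT N K M (fun C => δ < |(ksatMax C : ℝ) - expectedMax K N M|) ≤ M / δ ^ 2 := by
  have hc : (0 : ℝ) < Fintype.card (Fin M → Clause N K) := by exact_mod_cast Fintype.card_pos
  unfold probKSAT
  rw [div_le_div_iff₀ hc (by positivity)]
  refine le_trans ?_ sum_sub_expectedMax_sq_le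
  rw [← nsmul_eq_mul]
  refine (Finset.card_nsmul_le_sum _ (fun C => ((ksatMax C : ℝ) - expectedMax K N M) ^ 2) _
    fun C hC => ?_).trans
    (Finset.sum_le_sum_of_subset_of_nonneg (Finset.subset_univ _) fun _ _ _ => sq_nonneg _)
  have := (Finset.mem_filter.1 hC).2
  rw [← sq_abs (_ - _)]
  gcongr

theorem probKSAT_nonneg (p : (Fin M → Clause N K) → Prop) : 0 ≤ probKSAT N K M p := by
  unfold probKSAT
  positivity

theorem probKSAT_mono {p q : (Fin M → Clause N K) → Prop} (h : ∀ C, p C → q C) :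
    probKSAT N K M p ≤ probKSAT N K M q := by
  unfold probKSAT
  gcongr with C
  exact h C

end Concentration

/-- For a random `K`-SAT instance with `N` variables and `⌊cN⌋` clauses, the maximum
number of satisfiable clauses normalized by `N` converges with high probability to a
constant `H(c)`. -/
theorem ksat_scaling_limit (c : ℝ) (hc : 0 < c) (K : ℕ) (hK : 2 ≤ K) :
    ∃ H : ℝ,
      ∀ ε : ℝ, 0 < ε →
        Tendsto (fun N : ℕ =>
            probKSAT N K ⌊c * (N : ℝ)⌋₊
              (fun C => ε < |(ksatMax C : ℝ) / (N : ℝ) - H|))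
          atTop (nhds 0) := by
  obtain ⟨H, hH⟩ := exists_tendsto_expectedMax_div K hc
  refine ⟨H, fun ε hε => ?_⟩
  have hz : Tendsto (fun N : ℕ => 4 * c / ε ^ 2 * (1 / (N : ℝ))) atTop (nhds 0) := by
    have := tendsto_one_div_atTop_nhds_zero_nat (𝕜 := ℝ) |>.const_mul (4 * c / ε ^ 2)
    rwa [mul_zero] at this
  refine squeeze_zero' (Eventually.of_forall fun N => probKSAT_nonneg _) ?_ hz
  have hclose := (Metric.tendsto_nhds.1 hH) (ε / 2) (half_pos hε)
  filter_upwards [hclose, eventually_gt_atTop 0] with N hN hpos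
  have : NeZero N := ⟨hpos.ne'⟩
  have hN' : (0 : ℝ) < N := by exact_mod_cast hpos
  rw [Real.dist_eq] at hN
  have hδ : 0 < ε / 2 * N := by positivity
  refine (probKSAT_mono fun C hC => ?_).trans
    ((probKSAT_abs_sub_expectedMax_le hδ).trans ?_)
  · have htri := abs_sub_le ((ksatMax C : ℝ) / N) (expectedMax K N ⌊c * (N : ℝ)⌋₊ / N) H
    have : ε / 2 < |(ksatMax C : ℝ) / N - expectedMax K N ⌊c * (N : ℝ)⌋₊ / N| := by linarith
    rwa [← sub_div, abs_div, abs_of_pos hN', lt_div_iff₀ hN'] at this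
  · calc (⌊c * (N : ℝ)⌋₊ : ℝ) / (ε / 2 * N) ^ 2 ≤ c * N / (ε / 2 * N) ^ 2 := by
          gcongr
          exact Nat.floor_le (by positivity)
      _ = _ := by
          field_simp
          norm_num
end

section
/- Fix a real constant c > 0 and an integer K ≥ 2. For each N let G(N, ⌊cN⌋) be a random NAE-K-SAT instance with N variables and ⌊cN⌋ clauses, and let H_N denote the maximum number of simultaneously NAE-satisfied clauses. Then there exists a constant H(c) such that H_N / N converges to H(c) with high probability as N → ∞. -/
open Filter
open scoped Classical

/-- The maximum number of simultaneously NAE-satisfied clauses: an assignment `x`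
NAE-satisfies clause `m` iff the values of `x` on the clause's variables are neither
equal to the clause's tuple nor to its coordinatewise complement. -/
noncomputable def naeMax {N K M : ℕ} (C : Fin M → Clause N K) : ℕ :=
  Finset.sup (Finset.univ : Finset (Fin N → Bool)) (fun x =>
    ((Finset.univ : Finset (Fin M)).filter
      (fun m => (fun k => x ((C m).1 k)) ≠ (C m).2 ∧
                (fun k => x ((C m).1 k)) ≠ (fun k => !((C m).2 k)))).card)


section ShiftAverage

variable {S A B : Type*} [AddCommMonoid S] [Fintype A] [Fintype B]

/-- The operator averaging a function over the translates by `σ a`, with weights `p a`. -/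
noncomputable def shiftAvg (p : A → ℝ) (σ : A → S) : Module.End ℝ (S → ℝ) where
  toFun f s := ∑ a, p a * f (s + σ a)
  map_add' f g := by
    ext s
    simp [mul_add, Finset.sum_add_distrib]
  map_smul' r f := by
    ext s
    simp [Finset.mul_sum, mul_left_comm]

theorem shiftAvg_apply (p : A → ℝ) (σ : A → S) (f : S → ℝ) (s : S) :
    shiftAvg p σ f s = ∑ a, p a * f (s + σ a) := rfl

theorem shiftAvg_commute (p : A → ℝ) (σ : A → S) (q : B → ℝ) (τ : B → S) :
    Commute (shiftAvg p σ) (shiftAvg q τ) := by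
  refine LinearMap.ext fun f => funext fun s => ?_
  simp only [Module.End.mul_apply, shiftAvg_apply, Finset.mul_sum]
  rw [Finset.sum_comm]
  refine Finset.sum_congr rfl fun b _ => Finset.sum_congr rfl fun a _ => ?_
  rw [add_right_comm, mul_left_comm]

theorem shiftAvg_mono {p : A → ℝ} (hp : ∀ a, 0 ≤ p a) (σ : A → S) :
    Monotone (shiftAvg p σ) := fun _ _ h _ =>
  Finset.sum_le_sum fun a _ => mul_le_mul_of_nonneg_left (h _) (hp a)

theorem shiftAvg_pow_mono {p : A → ℝ} (hp : ∀ a, 0 ≤ p a) (σ : A → S) (n : ℕ) :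
    Monotone (shiftAvg p σ ^ n) := by
  rw [Module.End.coe_pow]
  exact (shiftAvg_mono hp σ).iterate n

theorem shiftAvg_pow_le {p : A → ℝ} {q : B → ℝ} (hp : ∀ a, 0 ≤ p a) (hq : ∀ b, 0 ≤ q b)
    (σ : A → S) (τ : B → S) {f : S → ℝ} (h : shiftAvg p σ f ≤ shiftAvg q τ f) (n : ℕ) :
    (shiftAvg p σ ^ n) f ≤ (shiftAvg q τ ^ n) f := by
  rw [Module.End.pow_apply, Module.End.pow_apply]
  refine Function.Commute.iterate_le_of_map_le (fun g => ?_) (shiftAvg_mono hp σ)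
    (shiftAvg_mono hq τ) h n
  exact LinearMap.congr_fun (shiftAvg_commute p σ q τ) g

theorem shiftAvg_pow_one {p : A → ℝ} (hp : ∑ a, p a = 1) (σ : A → S) (n : ℕ) :
    (shiftAvg p σ ^ n) 1 = 1 := by
  have h : shiftAvg p σ 1 = 1 := by
    ext s
    simp [shiftAvg_apply, hp]
  rw [Module.End.pow_apply]
  exact Function.iterate_fixed h n

/-- Averaging with the uniform weights. -/
noncomputable abbrev unifAvg (σ : A → S) : Module.End ℝ (S → ℝ) :=
  shiftAvg (fun _ => (Fintype.card A : ℝ)⁻¹) σ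

theorem unifAvg_pow_apply (σ : A → S) (f : S → ℝ) (n : ℕ) (s : S) :
    (unifAvg σ ^ n) f s =
      (∑ C : Fin n → A, f (s + ∑ m, σ (C m))) / (Fintype.card (Fin n → A) : ℝ) := by
  induction n generalizing s with
  | zero => simp
  | succ n ih =>
    rw [pow_succ', Module.End.mul_apply, shiftAvg_apply]
    simp only [ih]
    rw [← (Fin.consEquiv fun _ => A).sum_comp, Fintype.sum_prod_type, Finset.sum_div]
    refine Finset.sum_congr rfl fun a _ => ?_
    simp only [Fin.consEquiv, Equiv.coe_fn_mk, Fin.sum_univ_succ, Fin.cons_zero, Fin.cons_succ,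
      Fintype.card_pi, Finset.prod_const, Finset.card_univ, Fintype.card_fin, pow_succ',
      add_assoc]
    push_cast
    rw [div_eq_mul_inv, div_eq_mul_inv, mul_inv]
    ring

theorem inv_card_nonneg (_a : A) : 0 ≤ (Fintype.card A : ℝ)⁻¹ := by positivity

theorem sum_inv_card [Nonempty A] : ∑ _a : A, (Fintype.card A : ℝ)⁻¹ = 1 := by
  simp

theorem shiftAvg_pow_increment {p : A → ℝ} (hp : ∀ a, 0 ≤ p a) (hp1 : ∑ a, p a = 1)
    {σ : A → S} {f : S → ℝ} (h0 : ∀ a s, f s ≤ f (s + σ a))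
    (h1 : ∀ a s, f (s + σ a) ≤ f s + 1) (n : ℕ) :
    (shiftAvg p σ ^ n) f ≤ (shiftAvg p σ ^ (n + 1)) f ∧
      (shiftAvg p σ ^ (n + 1)) f ≤ (shiftAvg p σ ^ n) f + 1 := by
  have key0 : f ≤ shiftAvg p σ f := fun s => by
    rw [shiftAvg_apply]
    calc f s = ∑ a, p a * f s := by rw [← Finset.sum_mul, hp1, one_mul]
      _ ≤ _ := Finset.sum_le_sum fun a _ => mul_le_mul_of_nonneg_left (h0 a s) (hp a)
  have key1 : shiftAvg p σ f ≤ f + 1 := fun s => by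
    rw [shiftAvg_apply]
    calc _ ≤ ∑ a, p a * (f s + 1) :=
          Finset.sum_le_sum fun a _ => mul_le_mul_of_nonneg_left (h1 a s) (hp a)
      _ = _ := by rw [← Finset.sum_mul, hp1, one_mul]; rfl
  rw [pow_succ, Module.End.mul_apply]
  refine ⟨shiftAvg_pow_mono hp σ n key0, ?_⟩
  refine (shiftAvg_pow_mono hp σ n key1).trans_eq ?_
  rw [map_add, shiftAvg_pow_one hp1]

theorem shiftAvg_pow_lipschitz {p : A → ℝ} (hp : ∀ a, 0 ≤ p a) (hp1 : ∑ a, p a = 1)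
    {σ : A → S} {f : S → ℝ} (h0 : ∀ a s, f s ≤ f (s + σ a))
    (h1 : ∀ a s, f (s + σ a) ≤ f s + 1) (m n : ℕ) (s : S) :
    (shiftAvg p σ ^ m) f s - |(n : ℝ) - m| ≤ (shiftAvg p σ ^ n) f s := by
  have H := fun k => shiftAvg_pow_increment hp hp1 h0 h1 k
  have mono : Monotone fun k => (shiftAvg p σ ^ k) f s :=
    monotone_nat_of_le_succ fun k => (H k).1 s
  have up : ∀ k d : ℕ, (shiftAvg p σ ^ (k + d)) f s ≤ (shiftAvg p σ ^ k) f s + d := by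
    intro k d
    induction d with
    | zero => simp
    | succ d ih =>
      have := (H (k + d)).2 s
      simp only [Pi.add_apply, Pi.one_apply] at this
      push_cast
      rw [← add_assoc]
      linarith
  rcases le_total m n with h | h
  · have := mono h
    have := abs_nonneg ((n : ℝ) - m)
    simp only at *
    linarith
  · obtain ⟨d, rfl⟩ := Nat.exists_eq_add_of_le h
    have h2 : |(n : ℝ) - ((n + d : ℕ) : ℝ)| = d := by
      push_cast
      rw [sub_add_cancel_left, abs_neg, abs_of_nonneg (by positivity)]
    have := up n d
    rw [h2]
    linarith

theorem shiftAvg_pow_add_mem {p : A → ℝ} (hp : ∀ a, 0 ≤ p a) (hp1 : ∑ a, p a = 1)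
    {σ : A → S} {f : S → ℝ} (h0 : ∀ a s, f s ≤ f (s + σ a))
    (h1 : ∀ a s, f (s + σ a) ≤ f s + 1) (n : ℕ) (a : A) (s : S) :
    (shiftAvg p σ ^ n) f s ≤ (shiftAvg p σ ^ n) f (s + σ a) ∧
      (shiftAvg p σ ^ n) f (s + σ a) ≤ (shiftAvg p σ ^ n) f s + 1 := by
  induction n generalizing s with
  | zero => exact ⟨h0 a s, h1 a s⟩
  | succ n ih =>
    rw [pow_succ', Module.End.mul_apply, shiftAvg_apply, shiftAvg_apply]
    constructor
    · refine Finset.sum_le_sum fun b _ => mul_le_mul_of_nonneg_left ?_ (hp b)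
      rw [add_right_comm]
      exact (ih _).1
    · calc _ ≤ ∑ b, p b * ((shiftAvg p σ ^ n) f (s + σ b) + 1) := by
            refine Finset.sum_le_sum fun b _ => mul_le_mul_of_nonneg_left ?_ (hp b)
            rw [add_right_comm]
            exact (ih _).2
        _ = _ := by
            simp only [mul_add, Finset.sum_add_distrib, mul_one, hp1]

/-- The variance of a function with increments in `[0, 1]` after `n` independent shifts is at
most `n`. -/
theorem shiftAvg_pow_variance {p : A → ℝ} (hp : ∀ a, 0 ≤ p a) (hp1 : ∑ a, p a = 1)
    {σ : A → S} {f : S → ℝ} (h0 : ∀ a s, f s ≤ f (s + σ a))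
    (h1 : ∀ a s, f (s + σ a) ≤ f s + 1) (n : ℕ) (s : S) :
    (shiftAvg p σ ^ n) (f ^ 2) s ≤ (shiftAvg p σ ^ n) f s ^ 2 + n := by
  induction n generalizing s with
  | zero => simp
  | succ n ih =>
    have H := fun a => shiftAvg_pow_add_mem hp hp1 h0 h1 n a s
    rw [pow_succ', Module.End.mul_apply, shiftAvg_apply, Module.End.mul_apply, shiftAvg_apply]
    set g := (shiftAvg p σ ^ n) f s
    set u := fun a => (shiftAvg p σ ^ n) f (s + σ a) - g with hu
    have hg : ∀ a, (shiftAvg p σ ^ n) f (s + σ a) = g + u a := fun a => by simp [hu]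
    have hu0 : ∀ a, 0 ≤ u a := fun a => sub_nonneg.2 (H a).1
    have hu1 : ∀ a, u a ≤ 1 := fun a => by have := (H a).2; simp only [hu]; linarith
    have e1 : ∑ a, p a * (shiftAvg p σ ^ n) (f ^ 2) (s + σ a) ≤
        ∑ a, p a * (g ^ 2 + 2 * g * u a + 1 + n) := by
      refine Finset.sum_le_sum fun a _ => mul_le_mul_of_nonneg_left ?_ (hp a)
      have := ih (s + σ a)
      rw [hg] at this
      nlinarith [hu0 a, hu1 a]
    have e2 : ∑ a, p a * (g ^ 2 + 2 * g * u a + 1 + n) =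
        g ^ 2 + 2 * g * ∑ a, p a * u a + 1 + n := by
      simp only [mul_add, Finset.sum_add_distrib, ← Finset.sum_mul, hp1, Finset.mul_sum]
      simp [mul_left_comm]
    have e3 : ∑ a, p a * (shiftAvg p σ ^ n) f (s + σ a) = g + ∑ a, p a * u a := by
      simp only [hg, mul_add, Finset.sum_add_distrib, ← Finset.sum_mul, hp1, one_mul]
    rw [e3]
    push_cast
    nlinarith [sq_nonneg (∑ a, p a * u a)]

theorem lazy_shiftAvg_pow_nonneg {p : A → ℝ} (hp : ∀ a, 0 ≤ p a) (σ : A → S) {t : ℝ}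
    (ht0 : 0 ≤ t) (ht1 : t ≤ 1) {f : S → ℝ} (hf : 0 ≤ f) (n : ℕ) :
    0 ≤ (((1 - t) • (1 : Module.End ℝ (S → ℝ)) + t • shiftAvg p σ) ^ n) f := by
  induction n with
  | zero => exact hf
  | succ n ih =>
    rw [pow_succ', Module.End.mul_apply]
    have h : 0 ≤ shiftAvg p σ
        ((((1 - t) • (1 : Module.End ℝ (S → ℝ)) + t • shiftAvg p σ) ^ n) f) := by
      simpa using shiftAvg_mono hp σ ih
    exact add_nonneg (smul_nonneg (sub_nonneg.2 ht1) ih) (smul_nonneg ht0 h)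

end ShiftAverage

/-- Expansion of the powers of a lazy averaging operator. -/
theorem lazy_pow_apply {S : Type*} (T : Module.End ℝ (S → ℝ)) (p : ℝ) (f : S → ℝ) (n : ℕ) (s : S) :
    (((1 - p) • (1 : Module.End ℝ (S → ℝ)) + p • T) ^ n) f s =
      ∑ k ∈ Finset.range (n + 1), (bernsteinPolynomial ℝ n k).eval p * (T ^ k) f s := by
  have hc : Commute (p • T) ((1 - p) • (1 : Module.End ℝ (S → ℝ))) :=
    ((Commute.one_right T).smul_right _).smul_left _
  rw [add_comm, hc.add_pow, LinearMap.sum_apply, Finset.sum_apply]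
  refine Finset.sum_congr rfl fun k _ => ?_
  simp only [smul_pow, one_pow, bernsteinPolynomial, Polynomial.eval_mul, Polynomial.eval_pow,
    Polynomial.eval_sub, Polynomial.eval_one, Polynomial.eval_X, Polynomial.eval_natCast]
  rw [← nsmul_eq_mul']
  simp only [LinearMap.smul_apply, Module.End.mul_apply, Module.End.one_apply, map_smul,
    Pi.smul_apply, smul_eq_mul]
  rw [nsmul_eq_mul]
  ring

theorem bernstein_eval_nonneg {p : ℝ} (hp0 : 0 ≤ p) (hp1 : p ≤ 1) (n k : ℕ) :
    0 ≤ (bernsteinPolynomial ℝ n k).eval p := by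
  simp only [bernsteinPolynomial, Polynomial.eval_mul, Polynomial.eval_pow,
    Polynomial.eval_sub, Polynomial.eval_one, Polynomial.eval_X, Polynomial.eval_natCast]
  have : 0 ≤ 1 - p := sub_nonneg.2 hp1
  positivity

theorem bernstein_eval_sum (p : ℝ) (n : ℕ) :
    ∑ k ∈ Finset.range (n + 1), (bernsteinPolynomial ℝ n k).eval p = 1 := by
  have := congrArg (Polynomial.eval p) (bernsteinPolynomial.sum ℝ n)
  simpa [Polynomial.eval_finsetSum] using this

theorem bernstein_abs_sub_le {p : ℝ} (hp0 : 0 ≤ p) (hp1 : p ≤ 1) (n : ℕ) (m : ℝ) {L : ℝ}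
    (hL : 0 < L) :
    ∑ k ∈ Finset.range (n + 1), (bernsteinPolynomial ℝ n k).eval p * |(k : ℝ) - m| ≤
      (n * p + (n * p - m) ^ 2) / L + L := by
  have hb := bernstein_eval_nonneg hp0 hp1 n
  have hsum := bernstein_eval_sum p n
  have hvar : ∑ k ∈ Finset.range (n + 1), (n * p - k) ^ 2 * (bernsteinPolynomial ℝ n k).eval p =
      n * p * (1 - p) := by
    have := congrArg (Polynomial.eval p) (bernsteinPolynomial.variance ℝ n)
    simpa [Polynomial.eval_finsetSum] using this
  have hpt : ∀ k : ℕ, |(k : ℝ) - m| ≤ (n * p - k) ^ 2 / L + ((n * p - m) ^ 2 / L + L) := by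
    intro k
    have h1 : |(k : ℝ) - m| ≤ |n * p - k| + |n * p - m| := by
      have := abs_sub_le (k : ℝ) (n * p) m
      rwa [abs_sub_comm (k : ℝ) (n * p)] at this
    have h2 : ∀ t : ℝ, |t| ≤ t ^ 2 / L + L / 2 := fun t => by
      rw [← sq_abs t]
      have : |t| ^ 2 / L + L / 2 - |t| = ((|t| - L / 2) ^ 2 + L ^ 2 / 4) / L := by
        field_simp
        ring
      have h3 : 0 ≤ ((|t| - L / 2) ^ 2 + L ^ 2 / 4) / L := by positivity
      linarith
    linarith [h2 (n * p - k), h2 (n * p - m)]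
  calc _ ≤ ∑ k ∈ Finset.range (n + 1), (bernsteinPolynomial ℝ n k).eval p *
        ((n * p - k) ^ 2 / L + ((n * p - m) ^ 2 / L + L)) :=
        Finset.sum_le_sum fun k _ => mul_le_mul_of_nonneg_left (hpt k) (hb k)
    _ = n * p * (1 - p) / L + ((n * p - m) ^ 2 / L + L) := by
        simp only [mul_add, Finset.sum_add_distrib, ← Finset.sum_mul, hsum]
        rw [← hvar, Finset.sum_div]
        rw [one_mul, one_mul]
        congr 1
        exact Finset.sum_congr rfl fun k _ => by ring
    _ ≤ _ := by
        rw [← add_assoc, ← add_div]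
        have h : (n : ℝ) * p * (1 - p) ≤ n * p :=
          mul_le_of_le_one_right (by positivity) (by linarith)
        gcongr

section Score

variable {V W : Type*} {K : ℕ}

/-- The `0`-`1` score of an assignment at a clause: `1` iff it NAE-satisfies the clause. -/
def naeScore (e : (Fin K → V) × (Fin K → Bool)) (x : V → Bool) : ℕ :=
  if (fun k => x (e.1 k)) ≠ e.2 ∧ (fun k => x (e.1 k)) ≠ (fun k => !(e.2 k)) then 1 else 0

theorem naeScore_le_one (e : (Fin K → V) × (Fin K → Bool)) (x : V → Bool) :
    naeScore e x ≤ 1 := by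
  unfold naeScore
  split_ifs <;> simp

theorem naeScore_eq_zero_iff (e : (Fin K → V) × (Fin K → Bool)) (x : V → Bool) :
    naeScore e x = 0 ↔
      (fun k => x (e.1 k)) = e.2 ∨ (fun k => x (e.1 k)) = (fun k => !(e.2 k)) := by
  unfold naeScore
  split_ifs with h
  · simpa using h
  · simp only [true_iff]
    tauto

variable [Fintype V] [DecidableEq V] [Fintype W]

/-- The maximal total score of an assignment. -/
def maxScore (s : (V → Bool) → ℕ) : ℝ := ((Finset.univ.sup s : ℕ) : ℝ)

theorem le_maxScore (s : (V → Bool) → ℕ) (x : V → Bool) : (s x : ℝ) ≤ maxScore s :=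
  Nat.cast_le.2 (Finset.le_sup (Finset.mem_univ x))

theorem maxScore_le {s : (V → Bool) → ℕ} {r : ℝ} (h : ∀ x, (s x : ℝ) ≤ r) : maxScore s ≤ r := by
  obtain ⟨x, -, hx⟩ := Finset.exists_mem_eq_sup Finset.univ Finset.univ_nonempty s
  rw [maxScore, hx]
  exact h x

theorem exists_eq_maxScore (s : (V → Bool) → ℕ) : ∃ x, (s x : ℝ) = maxScore s := by
  obtain ⟨x, -, hx⟩ := Finset.exists_mem_eq_sup Finset.univ Finset.univ_nonempty s
  exact ⟨x, by rw [maxScore, hx]⟩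

theorem maxScore_le_add (e : (Fin K → V) × (Fin K → Bool)) (s : (V → Bool) → ℕ) :
    maxScore s ≤ maxScore (s + naeScore e) :=
  maxScore_le fun x => le_trans (by simp) (le_maxScore (s + naeScore e) x)

theorem maxScore_add_le (e : (Fin K → V) × (Fin K → Bool)) (s : (V → Bool) → ℕ) :
    maxScore (s + naeScore e) ≤ maxScore s + 1 :=
  maxScore_le fun x => by
    have h1 := le_maxScore s x
    have h2 : (naeScore e x : ℝ) ≤ 1 := by exact_mod_cast naeScore_le_one e x
    simp only [Pi.add_apply, Nat.cast_add]
    linarith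

theorem maxScore_add_eq (e : (Fin K → V) × (Fin K → Bool)) (s : (V → Bool) → ℕ) :
    maxScore (s + naeScore e) =
      maxScore s + 1 - if ∀ x, (s x : ℝ) = maxScore s → naeScore e x = 0 then 1 else 0 := by
  split_ifs with h
  · refine le_antisymm (maxScore_le fun x => ?_) (by simpa using maxScore_le_add e s)
    by_cases hx : (s x : ℝ) = maxScore s
    · simp [hx, h x hx]
    · have h1 : (s x : ℝ) < maxScore s := lt_of_le_of_ne (le_maxScore s x) hx
      have h2 : (s x : ℝ) + 1 ≤ maxScore s := by
        rw [maxScore] at h1 ⊢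
        exact_mod_cast h1
      have h3 : (naeScore e x : ℝ) ≤ 1 := by exact_mod_cast naeScore_le_one e x
      simp only [Pi.add_apply, Nat.cast_add]
      linarith
  · push Not at h
    obtain ⟨x, hx, hx1⟩ := h
    refine le_antisymm (by simpa using maxScore_add_le e s) ?_
    have h1 : naeScore e x = 1 := by have := naeScore_le_one e x; omega
    have := le_maxScore (s + naeScore e) x
    simpa [hx, h1] using this

/-- The number of clauses with variables `i` violated by all optimal assignments depends only on
whether the variables of the clause are all tied to each other by the optimal assignments. -/
theorem exists_violated_count (hK : 0 < K) (s : (V → Bool) → ℕ) :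
    ∃ (χ : V → ((V → Bool) → Bool)) (κ : ℝ), 0 ≤ κ ∧ ∀ i : Fin K → V,
      (∑ a : Fin K → Bool, if ∀ x, (s x : ℝ) = maxScore s → naeScore (i, a) x = 0
        then (1 : ℝ) else 0) = κ * ∑ y, ∏ k, if χ (i k) = y then 1 else 0 := by
  obtain ⟨x₀, hx₀⟩ := exists_eq_maxScore s
  set χ : V → ((V → Bool) → Bool) := fun v x =>
    if (s x : ℝ) = maxScore s then xor (x v) (x₀ v) else false with hχ
  refine ⟨χ, 2, by norm_num, fun i => ?_⟩
  have hne : ∀ b : Fin K → Bool, b ≠ fun k => !(b k) := fun b h => by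
    have := congrFun h ⟨0, hK⟩
    simp at this
  have hR : (∑ y, ∏ k, if χ (i k) = y then (1 : ℝ) else 0) =
      if ∀ k, χ (i k) = χ (i ⟨0, hK⟩) then 1 else 0 := by
    rw [Finset.sum_eq_single (χ (i ⟨0, hK⟩))]
    · rw [Finset.prod_ite_zero]
      simp
    · intro y _ hy
      exact Finset.prod_eq_zero (Finset.mem_univ ⟨0, hK⟩) (if_neg (Ne.symm hy))
    · simp
  rw [hR]
  split_ifs with h
  · have hset : ∀ a : Fin K → Bool,
        (∀ x, (s x : ℝ) = maxScore s → naeScore (i, a) x = 0) ↔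
          a ∈ ({fun k => x₀ (i k), fun k => !(x₀ (i k))} : Finset (Fin K → Bool)) := by
      intro a
      simp only [naeScore_eq_zero_iff, Finset.mem_insert, Finset.mem_singleton]
      constructor
      · intro ha
        rcases ha x₀ hx₀ with h1 | h1
        · exact Or.inl h1.symm
        · right
          funext k
          simpa using (congrArg (! ·) (congrFun h1 k)).symm
      · intro ha x hx
        have hc : ∀ k, xor (x (i k)) (x₀ (i k)) = xor (x (i ⟨0, hK⟩)) (x₀ (i ⟨0, hK⟩)) := by
          intro k
          have := congrFun (h k) x
          simpa only [hχ, if_pos hx] using this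
        rcases hd : xor (x (i ⟨0, hK⟩)) (x₀ (i ⟨0, hK⟩)) with _ | _
        · have hx' : (fun k => x (i k)) = fun k => x₀ (i k) := by
            funext k
            have := hc k
            rw [hd] at this
            simpa using this
          rw [hx']
          rcases ha with rfl | rfl <;> simp
        · have hx' : (fun k => x (i k)) = fun k => !(x₀ (i k)) := by
            funext k
            have := hc k
            rw [hd] at this
            revert this
            cases x (i k) <;> cases x₀ (i k) <;> simp
          rw [hx']
          rcases ha with rfl | rfl <;> simp
    simp only [hset]
    rw [Finset.sum_ite_mem, Finset.univ_inter, Finset.sum_const, Finset.card_pair (hne _)]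
    norm_num
  · rw [mul_zero]
    refine Finset.sum_eq_zero fun a _ => if_neg fun ha => h fun k => ?_
    funext x
    simp only [hχ]
    split_ifs with hx
    · have h0 := ha x₀ hx₀
      have h1 := ha x hx
      rw [naeScore_eq_zero_iff] at h0 h1
      rcases h0 with h0 | h0 <;> rcases h1 with h1 | h1 <;>
      · have e1 := congrFun h0 k
        have e2 := congrFun h0 ⟨0, hK⟩
        have e3 := congrFun h1 k
        have e4 := congrFun h1 ⟨0, hK⟩
        simp only at e1 e2 e3 e4
        rw [e1, e2, e3, e4]
        cases a k <;> cases a ⟨0, hK⟩ <;> rfl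
    · rfl

/-- The expected gain from one uniform clause whose variables are chosen through `ι`. -/
theorem sum_maxScore_add [Nonempty W] (s : (V → Bool) → ℕ) {χ : V → ((V → Bool) → Bool)} {κ : ℝ}
    (h : ∀ i : Fin K → V,
      (∑ a : Fin K → Bool, if ∀ x, (s x : ℝ) = maxScore s → naeScore (i, a) x = 0
        then (1 : ℝ) else 0) = κ * ∑ y, ∏ k, if χ (i k) = y then 1 else 0) (ι : W → V) :
    ∑ e : (Fin K → W) × (Fin K → Bool),
        (Fintype.card ((Fin K → W) × (Fin K → Bool)) : ℝ)⁻¹ *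
          maxScore (s + naeScore (fun k => ι (e.1 k), e.2)) =
      maxScore s + 1 -
        κ / 2 ^ K * ∑ y, ((∑ w, if χ (ι w) = y then 1 else 0) / (Fintype.card W : ℝ)) ^ K := by
  have hcard : (Fintype.card W : ℝ) ≠ 0 := by simp
  have h1 : ∑ e : (Fin K → W) × (Fin K → Bool),
      (if ∀ x, (s x : ℝ) = maxScore s → naeScore (fun k => ι (e.1 k), e.2) x = 0
        then (1 : ℝ) else 0) = κ * ∑ y, (∑ w, if χ (ι w) = y then (1 : ℝ) else 0) ^ K := by
    rw [Fintype.sum_prod_type]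
    simp only [h fun k => ι (_ : W)]
    rw [← Finset.mul_sum, Finset.sum_comm]
    simp only [Fintype.sum_pow]
  simp only [maxScore_add_eq]
  rw [← Finset.mul_sum, Finset.sum_sub_distrib, h1, Finset.sum_const, Finset.card_univ]
  simp only [div_pow, ← Finset.sum_div, Fintype.card_prod, Fintype.card_pi, Finset.prod_const,
    Finset.card_univ, Fintype.card_fin, Fintype.card_bool]
  push_cast
  rw [nsmul_eq_mul]
  push_cast
  field_simp

end Score

section Interpolation

variable {V J : Type*} {W : J → Type*} {K : ℕ} [Fintype V] [DecidableEq V] [Nonempty V]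
  [Fintype J] [DecidableEq J] [∀ j, Fintype (W j)] [∀ j, DecidableEq (W j)]

/-- The fraction of the variables lying in a block. -/
noncomputable def blockFraction (V W : Type*) [Fintype V] [Fintype W] : ℝ :=
  (Fintype.card W : ℝ) / Fintype.card V

theorem blockFraction_nonneg (V W : Type*) [Fintype V] [Fintype W] :
    0 ≤ blockFraction V W := by
  unfold blockFraction
  positivity

omit [DecidableEq V] [DecidableEq J] [∀ j, DecidableEq (W j)] in
theorem sum_blockFraction (e : (Σ j, W j) ≃ V) : ∑ j, blockFraction V (W j) = 1 := by
  have h : (Fintype.card V : ℝ) ≠ 0 := by simp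
  simp only [blockFraction]
  rw [← Finset.sum_div, div_eq_one_iff_eq h, ← Fintype.card_congr e, Fintype.card_sigma]
  push_cast
  rfl

/-- The weight of a clause in the model where a clause first picks a block with probability
proportional to its size and then picks its variables uniformly in the block. -/
noncomputable def blockWeight (V : Type*) (W : J → Type*) (K : ℕ) [Fintype V]
    [∀ j, Fintype (W j)] (a : Σ j, (Fin K → W j) × (Fin K → Bool)) : ℝ :=
  blockFraction V (W a.1) * (Fintype.card ((Fin K → W a.1) × (Fin K → Bool)) : ℝ)⁻¹

/-- The score of a clause inside a block, as a function of the assignments of all variables. -/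
def blockScore (e : (Σ j, W j) ≃ V) (a : Σ j, (Fin K → W j) × (Fin K → Bool)) :
    (V → Bool) → ℕ :=
  naeScore (fun k => e ⟨a.1, a.2.1 k⟩, a.2.2)

omit [DecidableEq V] [Nonempty V] [Fintype J] [DecidableEq J] [∀ j, DecidableEq (W j)] in
theorem blockWeight_nonneg (a : Σ j, (Fin K → W j) × (Fin K → Bool)) :
    0 ≤ blockWeight V W K a := by
  have := blockFraction_nonneg V (W a.1)
  unfold blockWeight
  positivity

omit [DecidableEq J] [∀ j, DecidableEq (W j)] in
theorem shiftAvg_block_le (hK : 0 < K) (e : (Σ j, W j) ≃ V) :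
    shiftAvg (blockWeight V W K) (blockScore e) maxScore ≤
      unifAvg (naeScore (V := V) (K := K)) maxScore := by
  intro s
  obtain ⟨χ, κ, hκ, h⟩ := exists_violated_count hK s
  have hglob := sum_maxScore_add s h (id : V → V)
  rw [shiftAvg_apply, shiftAvg_apply, Fintype.sum_sigma]
  refine le_of_le_of_eq ?_ hglob.symm
  have hloc : ∀ j, ∑ a : (Fin K → W j) × (Fin K → Bool),
      blockWeight V W K ⟨j, a⟩ * maxScore (s + blockScore e ⟨j, a⟩) =
      blockFraction V (W j) * (maxScore s + 1 - κ / 2 ^ K *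
        ∑ y, ((∑ w, if χ (e ⟨j, w⟩) = y then 1 else 0) / (Fintype.card (W j) : ℝ)) ^ K) := by
    intro j
    rcases isEmpty_or_nonempty (W j) with hj | hj
    · have h0 : blockFraction V (W j) = 0 := by simp [blockFraction]
      simp [blockWeight, h0]
    · rw [← sum_maxScore_add s h fun w => e ⟨j, w⟩, Finset.mul_sum]
      simp only [blockWeight, blockScore, mul_assoc]
  simp only [hloc, mul_sub, Finset.sum_sub_distrib, ← Finset.sum_mul, sum_blockFraction e, one_mul]
  refine sub_le_sub_left ?_ _
  simp only [mul_left_comm _ (κ / 2 ^ K)]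
  rw [← Finset.mul_sum]
  refine mul_le_mul_of_nonneg_left ?_ (by positivity)
  simp only [Finset.mul_sum]
  rw [Finset.sum_comm]
  refine Finset.sum_le_sum fun y _ => ?_
  have hmean : (∑ v, if χ (id v) = y then (1 : ℝ) else 0) / (Fintype.card V : ℝ) =
      ∑ j, blockFraction V (W j) *
        ((∑ w, if χ (e ⟨j, w⟩) = y then 1 else 0) / (Fintype.card (W j) : ℝ)) := by
    rw [← e.sum_comp, Fintype.sum_sigma, Finset.sum_div]
    refine Finset.sum_congr rfl fun j _ => ?_
    rcases isEmpty_or_nonempty (W j) with hj | hj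
    · simp
    · have hj : (Fintype.card (W j) : ℝ) ≠ 0 := by simp
      simp only [blockFraction, id]
      field_simp
  rw [hmean]
  refine Real.pow_arith_mean_le_arith_mean_pow _ _ _ (fun j _ => blockFraction_nonneg V _)
    (sum_blockFraction e) (fun j _ => ?_) K
  refine div_nonneg (Finset.sum_nonneg fun w _ => ?_) (Nat.cast_nonneg _)
  split_ifs <;> norm_num

omit [Nonempty V] [DecidableEq J] in
theorem sum_maxScore_le (e : (Σ j, W j) ≃ V) (s : ∀ j, (W j → Bool) → ℕ) :
    ∑ j, maxScore (s j) ≤ maxScore fun x : V → Bool => ∑ j, s j fun w => x (e ⟨j, w⟩) := by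
  choose x hx using fun j => exists_eq_maxScore (s j)
  refine le_trans (le_of_eq ?_)
    (le_maxScore _ fun v => x (e.symm v).1 (e.symm v).2)
  push_cast
  refine Finset.sum_congr rfl fun j _ => ?_
  rw [← hx j]
  congr 2
  funext w
  rw [e.symm_apply_apply]

theorem sum_lazy_pow_le_block_pow (e : (Σ j, W j) ≃ V) (n : ℕ) (s : ∀ j, (W j → Bool) → ℕ) :
    ∑ j, (((1 - blockFraction V (W j)) • (1 : Module.End ℝ (((W j → Bool) → ℕ) → ℝ)) +
        blockFraction V (W j) • unifAvg (naeScore (V := W j) (K := K))) ^ n) maxScore (s j) ≤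
      (shiftAvg (blockWeight V W K) (blockScore e) ^ n) maxScore
        (fun x => ∑ j, s j fun w => x (e ⟨j, w⟩)) := by
  induction n generalizing s with
  | zero => exact sum_maxScore_le e s
  | succ n ih =>
    simp only [pow_succ', Module.End.mul_apply]
    set G : ∀ j, ((W j → Bool) → ℕ) → ℝ := fun j =>
      (((1 - blockFraction V (W j)) • (1 : Module.End ℝ (((W j → Bool) → ℕ) → ℝ)) +
        blockFraction V (W j) • unifAvg (naeScore (V := W j) (K := K))) ^ n) maxScore with hG
    change ∑ j, ((1 - blockFraction V (W j)) * G j (s j) +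
      blockFraction V (W j) * unifAvg (naeScore (V := W j) (K := K)) (G j) (s j)) ≤ _
    rw [shiftAvg_apply, Fintype.sum_sigma]
    have hstep : ∀ (i : J) (a : (Fin K → W i) × (Fin K → Bool)),
        ∑ j, G j (s j) - G i (s i) + G i (s i + naeScore a) ≤
          (shiftAvg (blockWeight V W K) (blockScore e) ^ n) maxScore
            ((fun x => ∑ j, s j fun w => x (e ⟨j, w⟩)) + blockScore e ⟨i, a⟩) := by
      intro i a
      have h := ih (Function.update s i (s i + naeScore a))
      have h1 : (fun x : V → Bool => ∑ j, Function.update s i (s i + naeScore a) j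
          fun w => x (e ⟨j, w⟩)) =
          (fun x => ∑ j, s j fun w => x (e ⟨j, w⟩)) + blockScore e ⟨i, a⟩ := by
        funext x
        simp only [Pi.add_apply]
        rw [← Finset.add_sum_erase _ _ (Finset.mem_univ i),
          ← Finset.add_sum_erase (a := i) _ (fun j => s j _) (Finset.mem_univ i),
          Function.update_self, Pi.add_apply, add_right_comm]
        congr 1
        · congr 1
          refine Finset.sum_congr rfl fun j hj => ?_
          rw [Function.update_of_ne (Finset.ne_of_mem_erase hj)]
      rw [h1] at h
      refine le_trans (le_of_eq ?_) h
      rw [← Finset.add_sum_erase _ (fun j => G j (s j)) (Finset.mem_univ i),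
        ← Finset.add_sum_erase _ _ (Finset.mem_univ i), Function.update_self]
      have h2 : ∑ j ∈ Finset.univ.erase i, G j (Function.update s i (s i + naeScore a) j) =
          ∑ j ∈ Finset.univ.erase i, G j (s j) :=
        Finset.sum_congr rfl fun j hj => by
          rw [Function.update_of_ne (Finset.ne_of_mem_erase hj)]
      change _ = G i _ + ∑ j ∈ Finset.univ.erase i, G j _
      rw [h2]
      ring
    have hblock : ∀ i, blockFraction V (W i) * (∑ j, G j (s j) - G i (s i) +
        unifAvg (naeScore (V := W i) (K := K)) (G i) (s i)) ≤
        ∑ a : (Fin K → W i) × (Fin K → Bool), blockWeight V W K ⟨i, a⟩ *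
          (shiftAvg (blockWeight V W K) (blockScore e) ^ n) maxScore
            ((fun x => ∑ j, s j fun w => x (e ⟨j, w⟩)) + blockScore e ⟨i, a⟩) := by
      intro i
      rcases isEmpty_or_nonempty (W i) with hi | hi
      · have h0 : blockFraction V (W i) = 0 := by simp [blockFraction]
        simp [blockWeight, h0]
      · refine le_trans (le_of_eq ?_) (Finset.sum_le_sum fun a _ =>
          mul_le_mul_of_nonneg_left (hstep i a) (blockWeight_nonneg _))
        have hw : ∀ a, blockWeight V W K ⟨i, a⟩ = blockFraction V (W i) *
            (Fintype.card ((Fin K → W i) × (Fin K → Bool)) : ℝ)⁻¹ := fun _ => rfl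
        simp only [hw, mul_assoc]
        rw [← Finset.mul_sum]
        congr 1
        rw [shiftAvg_apply]
        simp only [mul_add, Finset.sum_add_distrib]
        rw [← Finset.sum_mul, sum_inv_card, one_mul]
    refine le_trans (le_of_eq ?_) (Finset.sum_le_sum fun i _ => hblock i)
    simp only [mul_add, mul_sub, sub_mul, one_mul, Finset.sum_add_distrib, Finset.sum_sub_distrib]
    rw [← Finset.sum_mul, sum_blockFraction e, one_mul]

end Interpolation

section Limit

/-- The expected maximal number of satisfied clauses with `N` variables and `M` clauses. -/
noncomputable def expMax (K N M : ℕ) : ℝ :=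
  (unifAvg (naeScore (V := Fin N) (K := K)) ^ M) maxScore 0

theorem maxScore_zero {V : Type*} [Fintype V] [DecidableEq V] :
    maxScore (0 : (V → Bool) → ℕ) = 0 := by
  obtain ⟨x, hx⟩ := exists_eq_maxScore (0 : (V → Bool) → ℕ)
  rw [← hx]
  simp

theorem expMax_nonneg (K N M : ℕ) : 0 ≤ expMax K N M := by
  have h := shiftAvg_pow_mono inv_card_nonneg (naeScore (V := Fin N) (K := K)) M
    (show (0 : ((Fin N → Bool) → ℕ) → ℝ) ≤ maxScore from fun s => Nat.cast_nonneg _) 0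
  rwa [map_zero] at h

theorem sub_abs_le_expMax (K : ℕ) {N : ℕ} (hN : 0 < N) (m n : ℕ) :
    expMax K N m - |(n : ℝ) - m| ≤ expMax K N n := by
  have : Nonempty (Fin N) := ⟨⟨0, hN⟩⟩
  exact shiftAvg_pow_lipschitz inv_card_nonneg sum_inv_card maxScore_le_add
    maxScore_add_le m n 0

theorem expMax_le (K : ℕ) {N : ℕ} (hN : 0 < N) (M : ℕ) : expMax K N M ≤ M := by
  have h := sub_abs_le_expMax K hN M 0
  have h0 : expMax K N 0 = 0 := by simp [expMax, maxScore_zero]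
  rw [h0] at h
  simp only [Nat.cast_zero, zero_sub, abs_neg, Nat.abs_cast] at h
  linarith

theorem expMax_block_le {K : ℕ} (hK : 0 < K) {n : ℕ} (hn : 0 < n) {N : ℕ} (hN : 0 < N)
    (M m : ℕ) {L : ℝ} (hL : 0 < L) :
    ((N / n : ℕ) : ℝ) * (expMax K n m -
      ((M * ((n : ℝ) / N) + (M * ((n : ℝ) / N) - m) ^ 2) / L + L)) ≤ expMax K N M := by
  rcases lt_or_ge N n with hlt | hle
  · rw [Nat.div_eq_of_lt hlt]
    simpa using expMax_nonneg K N M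
  have : Nonempty (Fin N) := ⟨⟨0, hN⟩⟩
  have : Nonempty (Fin n) := ⟨⟨0, hn⟩⟩
  set q := N / n
  let d : Option (Fin q) → ℕ := fun j => j.elim (N % n) fun _ => n
  have hd : Fintype.card (Σ j, Fin (d j)) = Fintype.card (Fin N) := by
    simp only [Fintype.card_sigma, Fintype.card_fin, Fintype.sum_option]
    change N % n + ∑ _j : Fin q, n = N
    rw [Finset.sum_const, Finset.card_univ, Fintype.card_fin, smul_eq_mul, mul_comm]
    exact Nat.mod_add_div N n
  let e := Fintype.equivOfCardEq hd
  have h1 := sum_lazy_pow_le_block_pow (K := K) e M fun _ => 0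
  have h2 := shiftAvg_pow_le (fun a => blockWeight_nonneg a) inv_card_nonneg _ _
    (shiftAvg_block_le hK e) M 0
  have hz : (fun x : Fin N → Bool => ∑ j, (0 : (Fin (d j) → Bool) → ℕ) fun w => x (e ⟨j, w⟩)) =
      0 := by
    funext x
    simp
  rw [hz] at h1
  refine le_trans ?_ (h1.trans h2)
  rw [Fintype.sum_option]
  have hfrac1 : ∀ k : ℕ, k ≤ N → blockFraction (Fin N) (Fin k) ≤ 1 := fun k hk => by
    simp only [blockFraction, Fintype.card_fin]
    exact div_le_one_of_le₀ (by exact_mod_cast hk) (by positivity)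
  have hrest := lazy_shiftAvg_pow_nonneg inv_card_nonneg
    (naeScore (V := Fin (d none)) (K := K)) (blockFraction_nonneg (Fin N) (Fin (d none)))
    (hfrac1 (N % n) ((Nat.mod_lt N hn).le.trans hle))
    (show (0 : ((Fin (d none) → Bool) → ℕ) → ℝ) ≤ maxScore from fun s => Nat.cast_nonneg _) M 0
  refine le_add_of_nonneg_of_le hrest ?_
  have hmain : expMax K n m -
      ((M * ((n : ℝ) / N) + (M * ((n : ℝ) / N) - m) ^ 2) / L + L) ≤
      (((1 - blockFraction (Fin N) (Fin n)) • (1 : Module.End ℝ (((Fin n → Bool) → ℕ) → ℝ)) +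
        blockFraction (Fin N) (Fin n) • unifAvg (naeScore (V := Fin n) (K := K))) ^ M)
        maxScore 0 := by
    have hp : blockFraction (Fin N) (Fin n) = (n : ℝ) / N := by simp [blockFraction]
    have hp0 := blockFraction_nonneg (Fin N) (Fin n)
    have hp1 := hfrac1 n hle
    rw [← hp]
    set p := blockFraction (Fin N) (Fin n)
    rw [lazy_pow_apply]
    have h3 := bernstein_abs_sub_le hp0 hp1 M m hL
    have h4 : ∑ k ∈ Finset.range (M + 1), (bernsteinPolynomial ℝ M k).eval p *
        (expMax K n m - |(k : ℝ) - m|) ≤ ∑ k ∈ Finset.range (M + 1),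
        (bernsteinPolynomial ℝ M k).eval p *
          (unifAvg (naeScore (V := Fin n) (K := K)) ^ k) maxScore 0 :=
      Finset.sum_le_sum fun k _ => mul_le_mul_of_nonneg_left (sub_abs_le_expMax K hn m k)
        (bernstein_eval_nonneg hp0 hp1 M k)
    refine le_trans ?_ h4
    simp only [mul_sub, Finset.sum_sub_distrib]
    rw [← Finset.sum_mul, bernstein_eval_sum, one_mul]
    linarith
  change _ ≤ ∑ _j : Fin q, (((1 - blockFraction (Fin N) (Fin n)) •
    (1 : Module.End ℝ (((Fin n → Bool) → ℕ) → ℝ)) +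
        blockFraction (Fin N) (Fin n) • unifAvg (naeScore (V := Fin n) (K := K))) ^ M)
        maxScore 0
  rw [Finset.sum_const, Finset.card_univ, Fintype.card_fin, nsmul_eq_mul]
  exact mul_le_mul_of_nonneg_left hmain (Nat.cast_nonneg _)

theorem expMax_density_le {c : ℝ} (hc : 0 < c) {K : ℕ} (hK : 0 < K) {n N : ℕ} (hn : 0 < n)
    (hN : 0 < N) :
    expMax K n ⌊c * (n : ℝ)⌋₊ / n - c * n / N - (c + 2) / √n ≤ expMax K N ⌊c * (N : ℝ)⌋₊ / N := by
  have hn' : (1 : ℝ) ≤ n := by exact_mod_cast hn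
  have hN' : (0 : ℝ) < N := by exact_mod_cast hN
  have hs : 0 < √(n : ℝ) := Real.sqrt_pos.2 (by linarith)
  have hs2 : √(n : ℝ) * √(n : ℝ) = n := Real.mul_self_sqrt (by linarith)
  set M := ⌊c * (N : ℝ)⌋₊ with hM
  set m := ⌊c * (n : ℝ)⌋₊ with hm
  have hM1 : (M : ℝ) ≤ c * N := Nat.floor_le (by positivity)
  have hM2 : c * N < M + 1 := Nat.lt_floor_add_one _
  have hm1 : (m : ℝ) ≤ c * n := Nat.floor_le (by positivity)
  have hm2 : c * n < m + 1 := Nat.lt_floor_add_one _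
  set F := expMax K n m with hF
  have hF0 : 0 ≤ F := expMax_nonneg K n m
  have hF1 : F ≤ c * n := (expMax_le K hn m).trans hm1
  have hG0 : 0 ≤ expMax K N M := expMax_nonneg K N M
  have hq1 : ((N / n : ℕ) : ℝ) * n ≤ N := by exact_mod_cast Nat.div_mul_le_self N n
  have hq2 : (N : ℝ) ≤ ((N / n : ℕ) : ℝ) * n + n := by
    have := Nat.div_add_mod N n
    have h2 := Nat.mod_lt N hn
    have : N ≤ N / n * n + n := by rw [mul_comm]; omega
    exact_mod_cast this
  have main := expMax_block_le hK hn hN M m hs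
  set q : ℝ := ((N / n : ℕ) : ℝ)
  have hq0 : 0 ≤ q := Nat.cast_nonneg _
  rcases lt_or_ge N n with hlt | hle
  · have h1 : F / n ≤ c := by rw [div_le_iff₀ (by linarith)]; exact hF1
    have h2 : c ≤ c * n / N := by
      rw [le_div_iff₀ hN']
      exact mul_le_mul_of_nonneg_left (by exact_mod_cast hlt.le) hc.le
    have h3 : 0 ≤ (c + 2) / √(n : ℝ) := by positivity
    have h4 : 0 ≤ expMax K N M / N := by positivity
    linarith
  have hnN : (n : ℝ) ≤ N := by exact_mod_cast hle
  have hp1 : (M : ℝ) * (n / N) ≤ c * n := by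
    calc (M : ℝ) * (n / N) ≤ c * N * (n / N) := by gcongr
      _ = c * n := by field_simp
  have hp2 : c * n - 1 ≤ (M : ℝ) * (n / N) := by
    have h1 : (n : ℝ) / N ≤ 1 := div_le_one_of_le₀ hnN hN'.le
    have h2 : (c * N - 1) * (n / N) ≤ (M : ℝ) * (n / N) :=
      mul_le_mul_of_nonneg_right (by linarith) (by positivity)
    have h3 : (c * N - 1) * ((n : ℝ) / N) = c * n - n / N := by field_simp
    linarith
  have herr : (M * ((n : ℝ) / N) + (M * ((n : ℝ) / N) - m) ^ 2) / √n + √n ≤ (c + 2) * √n := by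
    have h1 : (M * ((n : ℝ) / N) - m) ^ 2 ≤ 1 := by
      rw [sq_le_one_iff_abs_le_one, abs_le]
      constructor <;> linarith
    have h2 : (M * ((n : ℝ) / N) + (M * ((n : ℝ) / N) - m) ^ 2) / √n ≤ (c + 1) * √n := by
      rw [div_le_iff₀ hs, mul_assoc, hs2]
      nlinarith
    linarith
  have h5 : q * F - q * ((c + 2) * √n) ≤ expMax K N M := by
    refine le_trans ?_ main
    rw [← mul_sub]
    exact mul_le_mul_of_nonneg_left (by linarith) hq0
  have h6 : (N : ℝ) * (F / n) ≤ q * F + c * n := by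
    have h7 : F / n ≤ c := by rw [div_le_iff₀ (by linarith)]; exact hF1
    have h8 : 0 ≤ F / n := by positivity
    have h9 : F / n * n = F := by field_simp
    calc (N : ℝ) * (F / n) ≤ (q * n + n) * (F / n) := by gcongr
      _ = q * (F / n * n) + n * (F / n) := by ring
      _ ≤ q * F + n * c := by rw [h9]; gcongr
      _ = _ := by ring
  have h10 : q * ((c + 2) * √n) ≤ N * ((c + 2) / √n) := by
    calc q * ((c + 2) * √n) = q * (√n * √n) * ((c + 2) / √n) := by field_simp
      _ ≤ _ := by rw [hs2]; gcongr
  rw [le_div_iff₀ hN']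
  have h11 : c * n / N * N = c * n := by field_simp
  nlinarith

theorem exists_tendsto_of_almost_monotone {a : ℕ → ℝ} {B C D : ℝ}
    (h0 : ∀ n, 0 < n → 0 ≤ a n) (hB : ∀ n, 0 < n → a n ≤ B)
    (h : ∀ n N, 0 < n → 0 < N → a n - C * n / N - D / √n ≤ a N) :
    ∃ H, Tendsto a atTop (nhds H) := by
  have hbu : IsBoundedUnder (· ≤ ·) atTop a :=
    isBoundedUnder_of_eventually_le ((eventually_gt_atTop 0).mono hB)
  have hbl : IsBoundedUnder (· ≥ ·) atTop a :=
    isBoundedUnder_of_eventually_ge ((eventually_gt_atTop 0).mono h0)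
  have hlow : ∀ n, 0 < n → a n - D / √n ≤ liminf a atTop := by
    intro n hn
    have ht : Tendsto (fun N : ℕ => a n - C * n / N - D / √n) atTop (nhds (a n - 0 - D / √n)) :=
      (tendsto_const_nhds.sub (tendsto_const_div_atTop_nhds_zero_nat _)).sub tendsto_const_nhds
    rw [sub_zero] at ht
    rw [← ht.liminf_eq]
    exact liminf_le_liminf ((eventually_gt_atTop 0).mono fun N hN => h n N hn hN)
      ht.isBoundedUnder_ge hbu.isCoboundedUnder_ge
  have hs : Tendsto (fun n : ℕ => liminf a atTop + D / √(n : ℝ)) atTop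
      (nhds (liminf a atTop + 0)) :=
    tendsto_const_nhds.add (Tendsto.const_div_atTop
      (Real.tendsto_sqrt_atTop.comp tendsto_natCast_atTop_atTop) D)
  rw [add_zero] at hs
  have hup : limsup a atTop ≤ liminf a atTop := by
    conv_rhs => rw [← hs.limsup_eq]
    refine limsup_le_limsup ((eventually_gt_atTop 0).mono fun n hn => ?_)
      hbl.isCoboundedUnder_le hs.isBoundedUnder_le
    have := hlow n hn
    linarith
  exact ⟨liminf a atTop, tendsto_of_le_liminf_of_limsup_le le_rfl hup hbu hbl⟩

theorem naeMax_eq_maxScore {N K M : ℕ} (C : Fin M → Clause N K) :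
    (naeMax C : ℝ) = maxScore (0 + ∑ m, naeScore (C m)) := by
  rw [naeMax, maxScore]
  congr 2
  funext x
  rw [zero_add, Finset.sum_apply, Finset.card_filter]
  refine Finset.sum_congr rfl fun m _ => ?_
  unfold naeScore
  congr

theorem probKSAT_eq {N K M : ℕ} (P : ℝ → Prop) :
    probKSAT N K M (fun C => P (naeMax C)) =
      (unifAvg (naeScore (V := Fin N) (K := K)) ^ M)
        (fun s => if P (maxScore s) then 1 else 0) 0 := by
  rw [unifAvg_pow_apply, probKSAT]
  congr 1
  rw [Finset.card_filter]
  push_cast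
  refine Finset.sum_congr rfl fun C _ => ?_
  rw [naeMax_eq_maxScore]

theorem probKSAT_deviation_le (K : ℕ) {N : ℕ} (hN : 0 < N) (M : ℕ) {t : ℝ} (ht : 0 < t)
    {P : ℝ → Prop} (hP : ∀ x, P x → t ≤ |x - expMax K N M|) :
    probKSAT N K M (fun C => P (naeMax C)) ≤ M / t ^ 2 := by
  have : Nonempty (Fin N) := ⟨⟨0, hN⟩⟩
  rw [probKSAT_eq]
  set T := unifAvg (naeScore (V := Fin N) (K := K))
  have hvar := shiftAvg_pow_variance inv_card_nonneg sum_inv_card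
    (maxScore_le_add (V := Fin N) (K := K)) maxScore_add_le M 0
  set F := expMax K N M with hF
  have hle : (fun s => if P (maxScore s) then (1 : ℝ) else 0) ≤
      (t ^ 2)⁻¹ • ((maxScore : ((Fin N → Bool) → ℕ) → ℝ) ^ 2 - (2 * F) • maxScore +
        (F ^ 2) • (1 : ((Fin N → Bool) → ℕ) → ℝ)) := by
    intro s
    have hsq : (maxScore s - F) ^ 2 = maxScore s ^ 2 - 2 * F * maxScore s + F ^ 2 * 1 := by ring
    change _ ≤ (t ^ 2)⁻¹ * (maxScore s ^ 2 - 2 * F * maxScore s + F ^ 2 * 1)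
    rw [← hsq]
    dsimp only
    split_ifs with hs
    · rw [inv_mul_eq_div, one_le_div (by positivity), ← sq_abs (maxScore s - F)]
      exact pow_le_pow_left₀ ht.le (hP _ hs) 2
    · positivity
  refine (shiftAvg_pow_mono inv_card_nonneg naeScore M hle 0).trans ?_
  rw [map_smul, map_add, map_sub, map_smul, map_smul, shiftAvg_pow_one sum_inv_card]
  change (t ^ 2)⁻¹ * ((T ^ M) (maxScore ^ 2) 0 - 2 * F * F + F ^ 2 * 1) ≤ _
  rw [inv_mul_eq_div]
  refine div_le_div_of_nonneg_right ?_ (by positivity)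
  change (T ^ M) (maxScore ^ 2) 0 ≤ F ^ 2 + M at hvar
  linarith

end Limit

/-- For a random NAE-`K`-SAT instance with `N` variables and `⌊cN⌋` clauses, the maximum
number of NAE-satisfied clauses normalized by `N` converges with high probability to a
constant `H(c)`. -/
theorem nae_ksat_scaling_limit (c : ℝ) (hc : 0 < c) (K : ℕ) (hK : 2 ≤ K) :
    ∃ H : ℝ,
      ∀ ε : ℝ, 0 < ε →
        Tendsto (fun N : ℕ =>
            probKSAT N K ⌊c * (N : ℝ)⌋₊
              (fun C => ε < |(naeMax C : ℝ) / (N : ℝ) - H|))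
          atTop (nhds 0) := by
  obtain ⟨H, hH⟩ := exists_tendsto_of_almost_monotone (B := c) (C := c) (D := c + 2)
    (a := fun N => expMax K N ⌊c * (N : ℝ)⌋₊ / N)
    (fun N _ => div_nonneg (expMax_nonneg _ _ _) (Nat.cast_nonneg _))
    (fun N hN => by
      rw [div_le_iff₀ (by exact_mod_cast hN)]
      exact (expMax_le K hN _).trans (Nat.floor_le (by positivity)))
    (fun n N hn hN => expMax_density_le hc (by omega) hn hN)
  refine ⟨H, fun ε hε => ?_⟩
  have hlim : Tendsto (fun N : ℕ => 4 * c / ε ^ 2 / (N : ℝ)) atTop (nhds 0) :=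
    tendsto_const_div_atTop_nhds_zero_nat _
  have hclose : ∀ᶠ N : ℕ in atTop, |expMax K N ⌊c * (N : ℝ)⌋₊ / N - H| < ε / 2 := by
    have := Metric.tendsto_nhds.1 hH (ε / 2) (by positivity)
    simpa only [Real.dist_eq] using this
  refine squeeze_zero' (Eventually.of_forall fun N => ?_) ?_ hlim
  · unfold probKSAT
    positivity
  filter_upwards [hclose, eventually_gt_atTop 0] with N hN hN0
  have hN' : (0 : ℝ) < N := by exact_mod_cast hN0
  refine (probKSAT_deviation_le K hN0 ⌊c * (N : ℝ)⌋₊ (t := ε / 2 * N) (by positivity)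
    (P := fun x => ε < |x / N - H|) fun x hx => ?_).trans ?_
  · have h1 : |x / N - H| ≤ |x / N - expMax K N ⌊c * (N : ℝ)⌋₊ / N| +
        |expMax K N ⌊c * (N : ℝ)⌋₊ / N - H| := abs_sub_le _ _ _
    rw [← sub_div, abs_div, abs_of_pos hN'] at h1
    rw [← le_div_iff₀ hN']
    linarith
  · have h2 : (⌊c * (N : ℝ)⌋₊ : ℝ) ≤ c * N := Nat.floor_le (by positivity)
    calc (⌊c * (N : ℝ)⌋₊ : ℝ) / (ε / 2 * N) ^ 2 ≤ c * N / (ε / 2 * N) ^ 2 := by gcongr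
      _ = 4 * c / ε ^ 2 / N := by
        field_simp
        norm_num
end

section
/- Fix a real constant c > 0 and an integer K ≥ 2. Let p(N, M) denote the probability that a random K-SAT instance with N variables and M clauses is satisfiable (i.e., some assignment satisfies all M clauses). Then the limit p(c) = lim_{N→∞} N^{−1} log p(N, ⌊cN⌋) exists (as a real number). -/
open Filter
open scoped Classical

/-- `pSat N K M` is the probability that a random `K`-SAT instance with `N` variables and
`M` clauses is satisfiable. -/
noncomputable def pSat (N K M : ℕ) : ℝ :=
  probKSAT N K M (fun C => ∃ x : Fin N → Bool,
    ∀ m : Fin M, (fun k => x ((C m).1 k)) ≠ (C m).2)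

section StepAverage

variable {ι κ σ τ : Type*} [Fintype ι] [Fintype κ]

/-- The Markov operator averaging a function over the states reached by a uniformly random
step. -/
noncomputable def stepAverage (step : ι → σ → σ) : Module.End ℝ (σ → ℝ) :=
  (Fintype.card ι : ℝ)⁻¹ • ∑ c, LinearMap.funLeft ℝ ℝ (step c)

lemma stepAverage_apply (step : ι → σ → σ) (f : σ → ℝ) (s : σ) :
    stepAverage step f s = (Fintype.card ι : ℝ)⁻¹ * ∑ c, f (step c s) := by
  simp [stepAverage, LinearMap.sum_apply, LinearMap.funLeft_apply]

lemma stepAverage_mono (step : ι → σ → σ) : Monotone (stepAverage step) := by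
  intro f g h s
  rw [stepAverage_apply, stepAverage_apply]
  gcongr
  exact h _

lemma stepAverage_commute {step : ι → σ → σ} {step' : κ → σ → σ}
    (h : ∀ c c' s, step c (step' c' s) = step' c' (step c s)) :
    Commute (stepAverage step) (stepAverage step') := by
  refine Commute.smul_left (Commute.smul_right ?_ _) _
  refine Commute.sum_left _ _ _ fun c _ ↦ Commute.sum_right _ _ _ fun c' _ ↦ ?_
  refine LinearMap.ext fun f ↦ funext fun s ↦ ?_
  simp [Module.End.mul_apply, LinearMap.funLeft_apply, h]

/-- A semiconjugacy of step families intertwines the averaging operators. -/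
lemma stepAverage_pow_comp {step : ι → σ → σ} {step' : ι → τ → τ} {g : τ → σ}
    (h : ∀ c t, step c (g t) = g (step' c t)) (M : ℕ) (f : σ → ℝ) (t : τ) :
    (stepAverage step ^ M) f (g t) = (stepAverage step' ^ M) (f ∘ g) t := by
  induction M generalizing t with
  | zero => simp
  | succ M ih => simp only [pow_succ', Module.End.mul_apply, stepAverage_apply, h, ih]

lemma monotone_pow_end {A : Module.End ℝ (σ → ℝ)} (hA : Monotone A) (M : ℕ) :
    Monotone (A ^ M) := by
  rw [Module.End.coe_pow]
  exact hA.iterate M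

lemma monotone_smul_end {A : Module.End ℝ (σ → ℝ)} (hA : Monotone A) {r : ℝ} (hr : 0 ≤ r) :
    Monotone (r • A) := by
  intro f g hfg s
  exact mul_le_mul_of_nonneg_left (hA hfg s) hr

/-- Comparison of powers of commuting monotone operators at a single function. -/
lemma pow_apply_le_pow_apply {A B : Module.End ℝ (σ → ℝ)} (hA : Monotone A) (hB : Monotone B)
    (hAB : Commute A B) {f : σ → ℝ} (h : B f ≤ A f) (M : ℕ) : (B ^ M) f ≤ (A ^ M) f := by
  induction M with
  | zero => simp
  | succ M ih =>
    calc (B ^ (M + 1)) f = (B ^ M) (B f) := by rw [pow_succ, Module.End.mul_apply]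
      _ ≤ (B ^ M) (A f) := monotone_pow_end hB M h
      _ = A ((B ^ M) f) := by
        rw [← Module.End.mul_apply, ← Module.End.mul_apply, (hAB.pow_right M).eq]
      _ ≤ A ((A ^ M) f) := hA ih
      _ = (A ^ (M + 1)) f := by rw [pow_succ', Module.End.mul_apply]

lemma stepAverage_inter_pow_apply {X : Type*} (E : ι → Set X) (M : ℕ) (f : Set X → ℝ)
    (S : Set X) :
    (stepAverage (fun c S ↦ S ∩ E c) ^ M) f S =
      ((Fintype.card ι : ℝ) ^ M)⁻¹ * ∑ C : Fin M → ι, f (S ∩ ⋂ m, E (C m)) := by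
  induction M generalizing S with
  | zero => simp
  | succ M ih =>
    rw [pow_succ', Module.End.mul_apply, stepAverage_apply]
    simp only [ih]
    rw [← Finset.mul_sum, ← mul_assoc, ← mul_inv, ← pow_succ']
    congr 1
    rw [← (Fin.consEquiv fun _ : Fin (M + 1) ↦ ι).sum_comp, Fintype.sum_prod_type]
    refine Finset.sum_congr rfl fun c _ ↦ Finset.sum_congr rfl fun C _ ↦ ?_
    congr 1
    ext x
    simp [Fin.forall_fin_succ, Fin.consEquiv, and_assoc]

/-- A uniformly random step in a uniformly random coordinate. -/
def coordStep {q : ℕ} (step : ι → σ → σ) (c : Fin q × ι) (s : Fin q → σ) : Fin q → σ :=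
  Function.update s c.1 (step c.2 (s c.1))

lemma stepAverage_coordStep_prod {q : ℕ} (step : ι → σ → σ) (f : σ → ℝ) (k : Fin q → ℕ) :
    stepAverage (coordStep step) (fun s ↦ ∏ j, (stepAverage step ^ k j) f (s j)) =
      (q : ℝ)⁻¹ • ∑ j, fun s : Fin q → σ ↦
        ∏ l, (stepAverage step ^ (Function.update k j (k j + 1) l)) f (s l) := by
  funext s
  rw [stepAverage_apply]
  simp only [Pi.smul_apply, Finset.sum_apply, smul_eq_mul, Fintype.card_prod, Fintype.card_fin,
    Nat.cast_mul, mul_inv, Fintype.sum_prod_type, mul_assoc]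
  congr 1
  rw [Finset.mul_sum]
  refine Finset.sum_congr rfl fun j _ ↦ ?_
  have h1 (c : ι) : ∏ l, (stepAverage step ^ k l) f (coordStep step (j, c) s l) =
      (stepAverage step ^ k j) f (step c (s j)) *
        ∏ l ∈ Finset.univ.erase j, (stepAverage step ^ k l) f (s l) := by
    rw [← Finset.mul_prod_erase _ _ (Finset.mem_univ j)]
    congr 1
    · simp [coordStep]
    · refine Finset.prod_congr rfl fun l hl ↦ ?_
      simp [coordStep, Function.update_of_ne (Finset.ne_of_mem_erase hl)]
  simp only [h1]
  rw [← Finset.sum_mul, ← mul_assoc, ← stepAverage_apply,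
    ← Finset.mul_prod_erase _ _ (Finset.mem_univ j), Function.update_self, pow_succ',
    Module.End.mul_apply]
  congr 1
  refine Finset.prod_congr rfl fun l hl ↦ ?_
  rw [Function.update_of_ne (Finset.ne_of_mem_erase hl)]

end StepAverage

section Multinomial

/-- The expected value of `∑ j, (k j + X j - μ) ^ 2` for `X` multinomial with `M` trials and
uniform cell probabilities. -/
noncomputable def multinomialSpread {q : ℕ} (μ : ℝ) (M : ℕ) (k : Fin q → ℕ) : ℝ :=
  ∑ j, ((k j : ℝ) - μ) ^ 2 + 2 * M / q * ∑ j, ((k j : ℝ) - μ) + M + M * (M - 1) / q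

lemma sum_update_add_one {q : ℕ} (k : Fin q → ℕ) (j : Fin q) (g : ℕ → ℝ) :
    ∑ l, g (Function.update k j (k j + 1) l) = ∑ l, g (k l) + (g (k j + 1) - g (k j)) := by
  rw [← Finset.add_sum_erase _ _ (Finset.mem_univ j),
    ← Finset.add_sum_erase _ (fun l ↦ g (k l)) (Finset.mem_univ j), Function.update_self,
    Finset.sum_congr rfl fun l hl ↦ by
      rw [Function.update_of_ne (Finset.ne_of_mem_erase hl)]]
  ring

lemma multinomialSpread_succ {q : ℕ} (hq : 0 < q) (μ : ℝ) (M : ℕ) (k : Fin q → ℕ) :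
    (q : ℝ)⁻¹ * ∑ j, multinomialSpread μ M (Function.update k j (k j + 1)) =
      multinomialSpread μ (M + 1) k := by
  have hq' : (q : ℝ) ≠ 0 := by positivity
  have h (j : Fin q) : multinomialSpread μ M (Function.update k j (k j + 1)) =
      multinomialSpread μ M k + 2 * ((k j : ℝ) - μ) + 1 + 2 * M / q := by
    unfold multinomialSpread
    rw [sum_update_add_one k j fun n ↦ ((n : ℝ) - μ) ^ 2,
      sum_update_add_one k j fun n ↦ (n : ℝ) - μ]
    push_cast
    ring
  simp only [h, Finset.sum_add_distrib, ← Finset.mul_sum, Finset.sum_const, Finset.card_univ,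
    Fintype.card_fin, nsmul_eq_mul]
  unfold multinomialSpread
  push_cast
  field_simp
  ring

/-- Jensen's inequality along the Pólya-type recursion `G (M + 1) k = avg_j G M (k + e_j)`. -/
lemma exp_neg_le_of_recursion {q : ℕ} (hq : 0 < q) {A B μ : ℝ}
    {G : ℕ → (Fin q → ℕ) → ℝ}
    (h0 : ∀ k, Real.exp (-(∑ j, (A + B * ((k j : ℝ) - μ) ^ 2))) ≤ G 0 k)
    (hG : ∀ M k, G (M + 1) k = (q : ℝ)⁻¹ * ∑ j, G M (Function.update k j (k j + 1)))
    (M : ℕ) (k : Fin q → ℕ) :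
    Real.exp (-(q * A + B * multinomialSpread μ M k)) ≤ G M k := by
  have hq' : (q : ℝ) ≠ 0 := by positivity
  induction M generalizing k with
  | zero =>
    refine le_of_eq_of_le ?_ (h0 k)
    simp [multinomialSpread, Finset.sum_add_distrib, Finset.mul_sum]
  | succ M ih =>
    rw [hG]
    calc Real.exp (-(q * A + B * multinomialSpread μ (M + 1) k))
        = Real.exp (∑ j : Fin q, (q : ℝ)⁻¹ •
            -(q * A + B * multinomialSpread μ M (Function.update k j (k j + 1)))) := by
          rw [← multinomialSpread_succ hq]
          simp only [smul_eq_mul, ← Finset.mul_sum, Finset.sum_neg_distrib,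
            Finset.sum_add_distrib, Finset.sum_const, Finset.card_univ, Fintype.card_fin,
            nsmul_eq_mul]
          congr 1
          field_simp
      _ ≤ ∑ j : Fin q, (q : ℝ)⁻¹ •
            Real.exp (-(q * A + B * multinomialSpread μ M (Function.update k j (k j + 1)))) := by
          refine convexOn_exp.map_sum_le (fun _ _ ↦ by positivity) ?_ (fun _ _ ↦ Set.mem_univ _)
          simp [hq']
      _ ≤ _ := by
          simp only [smul_eq_mul, ← Finset.mul_sum]
          gcongr
          exact ih _

lemma multinomialSpread_zero_le {q : ℕ} (hq : 0 < q) (μ : ℝ) (M : ℕ) :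
    multinomialSpread μ M (fun _ : Fin q ↦ 0) ≤ (q * μ - M) ^ 2 / q + M := by
  have hq' : (0 : ℝ) < q := by positivity
  have h : multinomialSpread μ M (fun _ : Fin q ↦ 0) = (q * μ - M) ^ 2 / q + M - M / q := by
    simp only [multinomialSpread, Finset.sum_const, Finset.card_univ, Fintype.card_fin,
      nsmul_eq_mul]
    push_cast
    field_simp
    ring
  rw [h]
  have : (0 : ℝ) ≤ M / q := by positivity
  linarith

end Multinomial

section Satisfiability

variable {U V : Type*} {K : ℕ}

/-- Assignments on `V` satisfying a clause over `U`, whose variables are embedded by `φ`. -/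
def satSet (φ : U → V) (c : (Fin K → U) × (Fin K → Bool)) : Set (V → Bool) :=
  {x | (fun k ↦ x (φ (c.1 k))) ≠ c.2}

/-- Impose a clause over `U` on a set of assignments on `V`. -/
def imposeClause (φ : U → V) (c : (Fin K → U) × (Fin K → Bool)) (S : Set (V → Bool)) :
    Set (V → Bool) :=
  S ∩ satSet φ c

/-- The real-valued indicator of nonemptiness. -/
noncomputable def nonemptyInd {X : Type*} (S : Set X) : ℝ :=
  if S.Nonempty then 1 else 0

lemma nonemptyInd_nonneg {X : Type*} (S : Set X) : 0 ≤ nonemptyInd S := by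
  unfold nonemptyInd
  split_ifs <;> norm_num

lemma pSat_eq_stepAverage (N K M : ℕ) :
    pSat N K M =
      (stepAverage (imposeClause (K := K) (id : Fin N → Fin N)) ^ M) nonemptyInd Set.univ := by
  refine Eq.trans ?_ (stepAverage_inter_pow_apply (satSet (id : Fin N → Fin N)) M _ _).symm
  rw [pSat, probKSAT, div_eq_inv_mul, Finset.card_filter, Fintype.card_fun, Fintype.card_fin]
  push_cast
  congr 1
  refine Finset.sum_congr rfl fun C _ ↦ ?_
  simp [nonemptyInd, Set.Nonempty, satSet]

lemma sum_nonemptyInd_imposeClause [Fintype U] (φ : U → V) {S : Set (V → Bool)}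
    {x₀ : V → Bool} (hx₀ : x₀ ∈ S) :
    ∑ c : (Fin K → U) × (Fin K → Bool), nonemptyInd (imposeClause φ c S) =
      (Fintype.card U : ℝ) ^ K * 2 ^ K -
        ((Finset.univ.filter fun u ↦ ∀ x ∈ S, x (φ u) = x₀ (φ u)).card : ℝ) ^ K := by
  set F := Finset.univ.filter fun u ↦ ∀ x ∈ S, x (φ u) = x₀ (φ u) with hF
  have h (i : Fin K → U) (a : Fin K → Bool) : nonemptyInd (imposeClause φ (i, a) S) =
      1 - if a = fun k ↦ x₀ (φ (i k)) then (if ∀ k, i k ∈ F then 1 else 0) else 0 := by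
    have h' : (imposeClause φ (i, a) S).Nonempty ↔
        ¬ (a = (fun k ↦ x₀ (φ (i k))) ∧ ∀ k, i k ∈ F) := by
      rw [← not_iff_not, not_not, Set.not_nonempty_iff_eq_empty, Set.eq_empty_iff_forall_notMem]
      constructor
      · intro H
        have H' : ∀ x ∈ S, (fun k ↦ x (φ (i k))) = a := fun x hx ↦ by
          by_contra hne
          exact H x ⟨hx, hne⟩
        refine ⟨(H' x₀ hx₀).symm, fun k ↦ ?_⟩
        rw [hF, Finset.mem_filter]
        exact ⟨Finset.mem_univ _, fun x hx ↦ congrFun ((H' x hx).trans (H' x₀ hx₀).symm) k⟩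
      · rintro ⟨rfl, H⟩ x ⟨hx, hne⟩
        refine hne (funext fun k ↦ ?_)
        exact (Finset.mem_filter.mp (H k)).2 x hx
    unfold nonemptyInd
    rw [← ite_and]
    by_cases hc : a = (fun k ↦ x₀ (φ (i k))) ∧ ∀ k, i k ∈ F
    · rw [if_neg (by rw [h']; exact not_not.mpr hc), if_pos hc, sub_self]
    · rw [if_pos (h'.mpr hc), if_neg hc, sub_zero]
  have hcard : (Finset.univ.filter fun i : Fin K → U ↦ ∀ k, i k ∈ F).card = F.card ^ K := by
    rw [show (Finset.univ.filter fun i : Fin K → U ↦ ∀ k, i k ∈ F) =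
      Fintype.piFinset fun _ ↦ F by ext; simp, Fintype.card_piFinset]
    simp
  rw [Fintype.sum_prod_type]
  simp only [h, Finset.sum_sub_distrib, Finset.sum_ite_eq',
    Finset.mem_univ, if_true, Finset.sum_boole, hcard]
  simp

lemma stepAverage_imposeClause_nonemptyInd_le [Fintype U] (φ : U → V) :
    stepAverage (imposeClause (K := K) φ) nonemptyInd ≤ nonemptyInd := by
  intro S
  rw [stepAverage_apply]
  refine inv_mul_le_of_le_mul₀ (by positivity) (nonemptyInd_nonneg _) ?_
  refine (Finset.sum_le_card_nsmul _ _ (nonemptyInd S) fun c _ ↦ ?_).trans_eq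
    (by simp [nsmul_eq_mul])
  unfold nonemptyInd
  split_ifs with h1 h2 <;> norm_num
  exact h2 (h1.mono Set.inter_subset_left)

lemma le_stepAverage_imposeClause_nonemptyInd [Fintype U] [Nonempty U] (φ : U → V) :
    (1 - (2⁻¹ : ℝ) ^ K) • nonemptyInd ≤ stepAverage (imposeClause (K := K) φ) nonemptyInd := by
  intro S
  rw [stepAverage_apply, Pi.smul_apply, smul_eq_mul]
  by_cases hS : S.Nonempty
  · obtain ⟨x₀, hx₀⟩ := id hS
    rw [sum_nonemptyInd_imposeClause φ hx₀, nonemptyInd, if_pos hS]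
    set F := Finset.univ.filter fun u ↦ ∀ x ∈ S, x (φ u) = x₀ (φ u)
    have hF : (F.card : ℝ) ^ K ≤ (Fintype.card U : ℝ) ^ K := by
      gcongr
      exact F.card_le_univ
    have hU : (0 : ℝ) < Fintype.card U := by exact_mod_cast Fintype.card_pos
    simp only [Fintype.card_prod, Fintype.card_fun, Fintype.card_fin, Fintype.card_bool]
    push_cast
    rw [le_inv_mul_iff₀ (by positivity)]
    have : (2⁻¹ : ℝ) ^ K * 2 ^ K = 1 := by rw [← mul_pow]; norm_num
    linear_combination hF + (Fintype.card U : ℝ) ^ K * -this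
  · rw [nonemptyInd, if_neg hS, mul_zero]
    exact mul_nonneg (by positivity) (Finset.sum_nonneg fun _ _ ↦ nonemptyInd_nonneg _)

/-- Impose a clause inside one of `q` blocks of variables. -/
def imposeBlockClause {q n : ℕ} (φ : Fin q × Fin n → V) (c : Fin q × Clause n K)
    (S : Set (V → Bool)) : Set (V → Bool) :=
  imposeClause (fun i ↦ φ (c.1, i)) c.2 S

/-- The interpolation inequality: a clause confined to a random block is more likely to destroy
satisfiability than an unconstrained one. -/
lemma stepAverage_imposeBlockClause_le {q n : ℕ} (hq : 0 < q) (hn : 0 < n) (hK : K ≠ 0)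
    (φ : Fin q × Fin n → V) :
    stepAverage (imposeBlockClause (K := K) φ) nonemptyInd ≤
      stepAverage (imposeClause (K := K) φ) nonemptyInd := by
  intro S
  rw [stepAverage_apply, stepAverage_apply]
  by_cases hS : S.Nonempty
  · obtain ⟨x₀, hx₀⟩ := id hS
    rw [sum_nonemptyInd_imposeClause φ hx₀, Fintype.sum_prod_type]
    simp only [imposeBlockClause]
    have hb (j : Fin q) := sum_nonemptyInd_imposeClause (K := K) (fun i : Fin n ↦ φ (j, i)) hx₀
    simp only [hb]
    set F : Finset (Fin q × Fin n) := Finset.univ.filter fun u ↦ ∀ x ∈ S, x (φ u) = x₀ (φ u)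
    set f : Fin q → Finset (Fin n) :=
      fun j ↦ Finset.univ.filter fun i ↦ ∀ x ∈ S, x (φ (j, i)) = x₀ (φ (j, i))
    have hF : (F.card : ℝ) = ∑ j, ((f j).card : ℝ) := by
      simp only [F, f, Finset.card_filter, Fintype.sum_prod_type]
      push_cast
      rfl
    obtain ⟨k, rfl⟩ := Nat.exists_eq_succ_of_ne_zero hK
    have hpow := pow_sum_div_card_le_sum_pow (s := Finset.univ) (f := fun j ↦ ((f j).card : ℝ))
      (fun _ _ ↦ by positivity) k
    rw [← hF, Finset.card_univ, Fintype.card_fin] at hpow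
    have hq' : (0 : ℝ) < q := by positivity
    have hn' : (0 : ℝ) < n := by positivity
    rw [div_le_iff₀ (by positivity)] at hpow
    simp only [Finset.sum_sub_distrib, Finset.sum_const, Finset.card_univ, Fintype.card_prod,
      Fintype.card_fun, Fintype.card_fin, Fintype.card_bool, nsmul_eq_mul, Nat.cast_mul,
      Nat.cast_pow, Nat.cast_ofNat, Nat.succ_eq_add_one]
    rw [mul_sub, mul_sub, inv_mul_cancel₀ (by positivity), inv_mul_cancel₀ (by positivity),
      sub_le_sub_iff_left, inv_mul_eq_div, inv_mul_eq_div, div_le_div_iff₀ (by positivity)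
      (by positivity), mul_pow]
    have := mul_le_mul_of_nonneg_right hpow
      (show (0 : ℝ) ≤ q * (n ^ (k + 1) * 2 ^ (k + 1)) by positivity)
    refine this.trans_eq ?_
    ring
  · have h0 (T : Set (V → Bool)) (hT : T ⊆ S) : nonemptyInd T = 0 :=
      if_neg fun h ↦ hS (h.mono hT)
    simp [imposeBlockClause, imposeClause, h0 _ Set.inter_subset_left]

lemma imposeClause_comm {U' : Type*} (φ : U → V) (φ' : U' → V)
    (c : (Fin K → U) × (Fin K → Bool)) (c' : (Fin K → U') × (Fin K → Bool))
    (S : Set (V → Bool)) :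
    imposeClause φ c (imposeClause φ' c' S) = imposeClause φ' c' (imposeClause φ c S) :=
  Set.inter_right_comm _ _ _

/-- Restricting the variables of a clause to the range of an injection. -/
lemma smul_stepAverage_imposeClause_le [Fintype U] [Fintype V] {φ : U → V}
    (hφ : Function.Injective φ) [Nonempty U] {f : Set (V → Bool) → ℝ} (hf : 0 ≤ f) :
    ((Fintype.card U / Fintype.card V : ℝ) ^ K) • stepAverage (imposeClause (K := K) φ) f ≤
      stepAverage (imposeClause (K := K) id) f := by
  intro S
  have hU : (0 : ℝ) < Fintype.card U := by exact_mod_cast Fintype.card_pos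
  rw [Pi.smul_apply, stepAverage_apply, stepAverage_apply, smul_eq_mul, ← mul_assoc]
  simp only [Fintype.card_prod, Fintype.card_fun, Fintype.card_fin, Fintype.card_bool]
  push_cast
  rw [show ((Fintype.card U / Fintype.card V : ℝ) ^ K) *
    ((Fintype.card U : ℝ) ^ K * 2 ^ K)⁻¹ = ((Fintype.card V : ℝ) ^ K * 2 ^ K)⁻¹ by
      rw [div_pow]; field_simp]
  gcongr
  let g : (Fin K → U) × (Fin K → Bool) → (Fin K → V) × (Fin K → Bool) :=
    fun c ↦ (φ ∘ c.1, c.2)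
  have hg : Function.Injective g := hφ.comp_left.prodMap Function.injective_id
  calc ∑ c, f (imposeClause φ c S) = ∑ c ∈ Finset.univ.map ⟨g, hg⟩, f (imposeClause id c S) := by
        rw [Finset.sum_map]; rfl
    _ ≤ _ := Finset.sum_le_univ_sum_of_nonneg fun c ↦ hf _

/-- The set of assignments whose restriction to each block lies in a given set. -/
def blockProduct {q n : ℕ} (φ : Fin q × Fin n → V) (S : Fin q → Set (Fin n → Bool)) :
    Set (V → Bool) :=
  {x | ∀ j, (fun i ↦ x (φ (j, i))) ∈ S j}

lemma imposeBlockClause_blockProduct {q n : ℕ} (φ : Fin q × Fin n → V)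
    (c : Fin q × Clause n K) (S : Fin q → Set (Fin n → Bool)) :
    imposeBlockClause φ c (blockProduct φ S) =
      blockProduct φ (coordStep (imposeClause id) c S) := by
  ext x
  simp only [imposeBlockClause, imposeClause, blockProduct, coordStep, Set.mem_inter_iff,
    Set.mem_ofPred_eq, satSet]
  constructor
  · rintro ⟨h1, h2⟩ j
    by_cases hj : j = c.1
    · subst hj
      rw [Function.update_self]
      exact ⟨h1 _, h2⟩
    · rw [Function.update_of_ne hj]
      exact h1 j
  · intro h
    have hc := h c.1
    rw [Function.update_self] at hc
    refine ⟨fun j ↦ ?_, hc.2⟩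
    by_cases hj : j = c.1
    · subst hj
      exact hc.1
    · have := h j
      rwa [Function.update_of_ne hj] at this

lemma nonemptyInd_blockProduct {q n : ℕ} {φ : Fin q × Fin n → V}
    (hφ : Function.Injective φ) (S : Fin q → Set (Fin n → Bool)) :
    nonemptyInd (blockProduct φ S) = ∏ j, nonemptyInd (S j) := by
  have h : (blockProduct φ S).Nonempty ↔ ∀ j, (S j).Nonempty := by
    constructor
    · rintro ⟨x, hx⟩ j
      exact ⟨_, hx j⟩
    · intro h
      choose y hy using h
      refine ⟨Function.extend φ (fun u ↦ y u.1 u.2) fun _ ↦ false, fun j ↦ ?_⟩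
      simpa only [hφ.extend_apply] using hy j
  simp only [nonemptyInd, h, Finset.prod_ite_zero, Finset.prod_const_one, Finset.mem_univ,
    true_imp_iff]

end Satisfiability

section Rate

variable {K : ℕ}

lemma pSat_zero {N : ℕ} : pSat N K 0 = 1 := by
  simp [pSat_eq_stepAverage, nonemptyInd]

lemma pSat_antitone (N K : ℕ) : Antitone (pSat N K) := by
  refine antitone_nat_of_succ_le fun M ↦ ?_
  rw [pSat_eq_stepAverage, pSat_eq_stepAverage, pow_succ, Module.End.mul_apply]
  exact monotone_pow_end (stepAverage_mono _) M
    (stepAverage_imposeClause_nonemptyInd_le id) Set.univ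

lemma mul_pSat_le_pSat_succ {N : ℕ} (hN : 0 < N) (M : ℕ) :
    (1 - (2⁻¹ : ℝ) ^ K) * pSat N K M ≤ pSat N K (M + 1) := by
  have : Nonempty (Fin N) := Fin.pos_iff_nonempty.mp hN
  have := monotone_pow_end
    (stepAverage_mono (imposeClause (K := K) (id : Fin N → Fin N))) M
    (le_stepAverage_imposeClause_nonemptyInd (K := K) (id : Fin N → Fin N)) Set.univ
  rw [map_smul] at this
  rw [pSat_eq_stepAverage, pSat_eq_stepAverage, pow_succ, Module.End.mul_apply]
  exact this

lemma one_sub_two_inv_pow_pos (hK : K ≠ 0) : 0 < 1 - (2⁻¹ : ℝ) ^ K :=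
  sub_pos.mpr (pow_lt_one₀ (by norm_num) (by norm_num) hK)

lemma pSat_pos {N : ℕ} (hN : 0 < N) (hK : K ≠ 0) (M : ℕ) : 0 < pSat N K M := by
  induction M with
  | zero => rw [pSat_zero]; exact one_pos
  | succ M ih =>
    exact (mul_pos (one_sub_two_inv_pow_pos hK) ih).trans_le (mul_pSat_le_pSat_succ hN M)

lemma log_pSat_nonpos (N M : ℕ) : Real.log (pSat N K M) ≤ 0 := by
  refine Real.log_nonpos ?_ ((pSat_antitone N K M.zero_le).trans_eq pSat_zero)
  unfold pSat probKSAT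
  positivity

/-- An upper bound for the cost, in `log pSat`, of one additional clause. -/
noncomputable def clauseCost (K : ℕ) : ℝ := -Real.log (1 - (2⁻¹ : ℝ) ^ K)

lemma clauseCost_nonneg (hK : K ≠ 0) : 0 ≤ clauseCost K :=
  neg_nonneg.mpr (Real.log_nonpos (one_sub_two_inv_pow_pos hK).le
    (sub_le_self _ (by positivity)))

lemma log_pSat_sub_le_log_pSat_add {N : ℕ} (hN : 0 < N) (hK : K ≠ 0) (M s : ℕ) :
    Real.log (pSat N K M) - clauseCost K * s ≤ Real.log (pSat N K (M + s)) := by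
  induction s with
  | zero => simp
  | succ s ih =>
    have h := Real.log_le_log (mul_pos (one_sub_two_inv_pow_pos hK) (pSat_pos hN hK (M + s)))
      (mul_pSat_le_pSat_succ hN (M + s))
    rw [Real.log_mul (one_sub_two_inv_pow_pos hK).ne' (pSat_pos hN hK _).ne'] at h
    rw [← add_assoc]
    push_cast
    unfold clauseCost at ih ⊢
    linarith

lemma log_pSat_sub_abs_le {N : ℕ} (hN : 0 < N) (hK : K ≠ 0) (M k : ℕ) :
    Real.log (pSat N K M) - clauseCost K * |(k : ℝ) - M| ≤ Real.log (pSat N K k) := by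
  rcases le_total M k with h | h
  · obtain ⟨s, rfl⟩ := Nat.exists_eq_add_of_le h
    have := log_pSat_sub_le_log_pSat_add hN hK M s
    push_cast
    rwa [add_sub_cancel_left, abs_of_nonneg (Nat.cast_nonneg s)]
  · have h1 := Real.log_le_log (pSat_pos hN hK M) (pSat_antitone N K h)
    have h2 := mul_nonneg (clauseCost_nonneg hK) (abs_nonneg ((k : ℝ) - M))
    linarith

/-- Block interpolation: if `-log (pSat n K k)` is dominated by a parabola, then
`-log (pSat N K M)` is controlled by `q` copies of it, for `q * n ≤ N`. -/
lemma le_log_pSat_of_blocks {q n N : ℕ} (hq : 0 < q) (hn : 0 < n) (hN : q * n ≤ N)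
    (hK : K ≠ 0) {A B μ : ℝ} (hB : 0 ≤ B)
    (h : ∀ k : ℕ, -(A + B * ((k : ℝ) - μ) ^ 2) ≤ Real.log (pSat n K k)) (M : ℕ) :
    M * (K * Real.log (q * n / N)) - (q * A + B * ((q * μ - M) ^ 2 / q + M)) ≤
      Real.log (pSat N K M) := by
  have hN0 : 0 < N := (Nat.mul_pos hq hn).trans_le hN
  have : Nonempty (Fin q × Fin n) := ⟨⟨0, hq⟩, ⟨0, hn⟩⟩
  let φ : Fin q × Fin n → Fin N := fun u ↦ Fin.castLE hN (finProdFinEquiv u)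
  have hφ : Function.Injective φ :=
    (Fin.castLE_injective hN).comp finProdFinEquiv.injective
  set r : ℝ := (q * n / N) ^ K with hr
  have hr0 : 0 < r := by positivity
  set T := stepAverage (imposeClause (K := K) (id : Fin N → Fin N))
  set T' := stepAverage (imposeBlockClause (K := K) φ)
  have hmono : Monotone (r • T') := monotone_smul_end (stepAverage_mono _) hr0.le
  have hcomm : Commute T T' := stepAverage_commute fun c c' S ↦
    imposeClause_comm id (fun i ↦ φ (c'.1, i)) c c'.2 S
  have hle : (r • T') nonemptyInd ≤ T nonemptyInd := by
    have h1 := smul_le_smul_of_nonneg_left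
      (stepAverage_imposeBlockClause_le (K := K) hq hn hK φ) hr0.le
    have h2 := smul_stepAverage_imposeClause_le (K := K) hφ (f := nonemptyInd) nonemptyInd_nonneg
    simp only [Fintype.card_prod, Fintype.card_fin, Nat.cast_mul] at h2
    rw [LinearMap.smul_apply]
    exact h1.trans h2
  have h1 : r ^ M * (T' ^ M) nonemptyInd Set.univ ≤ pSat N K M := by
    have := pow_apply_le_pow_apply (stepAverage_mono _) hmono (hcomm.smul_right r) hle M Set.univ
    rw [smul_pow] at this
    rw [pSat_eq_stepAverage]
    exact this
  set T₀ := stepAverage (imposeClause (K := K) (id : Fin n → Fin n))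
  let F : (Fin q → ℕ) → (Fin q → Set (Fin n → Bool)) → ℝ :=
    fun k S ↦ ∏ j, (T₀ ^ k j) nonemptyInd (S j)
  let G : ℕ → (Fin q → ℕ) → ℝ := fun M k ↦
    (stepAverage (coordStep (imposeClause (K := K) id)) ^ M) (F k) fun _ ↦ Set.univ
  have h2 : (T' ^ M) nonemptyInd Set.univ = G M fun _ ↦ 0 := by
    have huniv : (Set.univ : Set (Fin N → Bool)) = blockProduct φ fun _ ↦ Set.univ := by
      ext; simp [blockProduct]
    rw [huniv, stepAverage_pow_comp (imposeBlockClause_blockProduct φ)]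
    have hF : nonemptyInd ∘ blockProduct φ = F fun _ ↦ 0 := by
      funext S
      simpa [F] using nonemptyInd_blockProduct hφ S
    rw [hF]
  have h3 := exp_neg_le_of_recursion hq (A := A) (B := B) (μ := μ) (G := G) ?_ ?_ M fun _ ↦ 0
  · have h4 : Real.exp (-(q * A + B * ((q * μ - M) ^ 2 / q + M))) ≤ G M fun _ ↦ 0 := by
      refine le_trans ?_ h3
      gcongr
      exact multinomialSpread_zero_le hq μ M
    have h5 : r ^ M * Real.exp (-(q * A + B * ((q * μ - M) ^ 2 / q + M))) ≤ pSat N K M := by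
      refine le_trans ?_ h1
      rw [h2]
      gcongr
    have h6 := Real.log_le_log (by positivity) h5
    rwa [Real.log_mul (by positivity) (by positivity), Real.log_exp, Real.log_pow, hr,
      Real.log_pow, ← sub_eq_add_neg] at h6
  · intro k
    simp only [G, F, pow_zero, Module.End.one_apply, T₀, ← pSat_eq_stepAverage]
    rw [← Finset.sum_neg_distrib, Real.exp_sum]
    gcongr with j
    rw [← Real.le_log_iff_exp_le (pSat_pos hn hK _)]
    exact h _
  · intro M k
    simp only [G]
    rw [pow_succ, Module.End.mul_apply, stepAverage_coordStep_prod, map_smul, map_sum]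
    simp [Finset.sum_apply, F, T₀]

lemma neg_add_mul_sq_le_log_pSat {c : ℝ} (hc : 0 < c) {n : ℕ} (hn : 0 < n) (hK : K ≠ 0)
    {s : ℝ} (hs : 0 < s) (k : ℕ) :
    -((-Real.log (pSat n K ⌊c * n⌋₊) + clauseCost K * (1 + s / 2)) +
      clauseCost K / (2 * s) * ((k : ℝ) - c * n) ^ 2) ≤ Real.log (pSat n K k) := by
  have h1 := log_pSat_sub_abs_le hn hK ⌊c * n⌋₊ k
  have h2 : |(k : ℝ) - ⌊c * n⌋₊| ≤ |(k : ℝ) - c * n| + 1 := by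
    have h3 := Nat.floor_le (show 0 ≤ c * n by positivity)
    have h4 := Nat.lt_floor_add_one (c * n)
    have h5 := abs_sub_le (k : ℝ) (c * n) ⌊c * n⌋₊
    have h6 : |c * n - ⌊c * n⌋₊| ≤ 1 := by rw [abs_le]; constructor <;> linarith
    linarith
  have h3 : |(k : ℝ) - c * n| ≤ s / 2 + ((k : ℝ) - c * n) ^ 2 / (2 * s) := by
    rw [← sq_abs ((k : ℝ) - c * n)]
    set y := |(k : ℝ) - c * n|
    have : s / 2 + y ^ 2 / (2 * s) - y = (y - s) ^ 2 / (2 * s) := by field_simp; ring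
    have : 0 ≤ (y - s) ^ 2 / (2 * s) := by positivity
    linarith
  have h4 := mul_le_mul_of_nonneg_left (h2.trans (add_le_add_left h3 1)) (clauseCost_nonneg hK)
  have h5 : clauseCost K / (2 * s) * ((k : ℝ) - c * n) ^ 2 =
    clauseCost K * (((k : ℝ) - c * n) ^ 2 / (2 * s)) := by ring
  rw [h5]
  linarith

/-- Approximate superadditivity of the normalized logarithm. -/
lemma inv_mul_log_pSat_ge {c : ℝ} (hc : 0 < c) (hK : K ≠ 0) {n N : ℕ} (hn : 0 < n)
    (hnN : n ≤ N) {s : ℝ} (hs : 0 < s) :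
    (n : ℝ)⁻¹ * Real.log (pSat n K ⌊c * n⌋₊) -
        (clauseCost K * (1 + s / 2) / n + clauseCost K / (2 * s) * c) -
        (c * K + clauseCost K / (2 * s) * (1 + c * n) ^ 2) / (N / n : ℕ) ≤
      (N : ℝ)⁻¹ * Real.log (pSat N K ⌊c * N⌋₊) := by
  set q := N / n
  have hq : 0 < q := Nat.div_pos hnN hn
  have hqN : q * n ≤ N := Nat.div_mul_le_self N n
  have hNq : N < q * n + n := by
    have h1 := Nat.div_add_mod N n
    have h2 := Nat.mod_lt N hn
    have h3 : n * (N / n) = q * n := mul_comm _ _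
    omega
  have hL := clauseCost_nonneg hK
  have hmain := le_log_pSat_of_blocks hq hn hqN hK (B := clauseCost K / (2 * s))
    (by positivity) (neg_add_mul_sq_le_log_pSat hc hn hK hs) ⌊c * N⌋₊
  set l := Real.log (pSat n K ⌊c * n⌋₊)
  have hl : l ≤ 0 := log_pSat_nonpos _ _
  set L := clauseCost K
  set M := ⌊c * N⌋₊
  have hM1 : (M : ℝ) ≤ c * N := Nat.floor_le (by positivity)
  have hM2 : c * N < M + 1 := Nat.lt_floor_add_one _
  have hn' : (1 : ℝ) ≤ n := by exact_mod_cast hn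
  have hq' : (1 : ℝ) ≤ q := by exact_mod_cast hq
  have hqN' : (q : ℝ) * n ≤ N := by exact_mod_cast hqN
  have hNq' : (N : ℝ) ≤ q * n + n := by exact_mod_cast hNq.le
  have hN' : (1 : ℝ) ≤ N := by nlinarith
  have hlog : -(1 / (q : ℝ)) ≤ Real.log (q * n / N) := by
    have h1 := Real.one_sub_inv_le_log_of_pos (show (0 : ℝ) < q * n / N by positivity)
    have h2 : ((q : ℝ) * n / N)⁻¹ ≤ 1 + 1 / q := by
      rw [inv_div, div_le_iff₀ (by positivity)]
      refine hNq'.trans_eq ?_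
      field_simp
    linarith
  have hlog' : -(N * (c * K / q)) ≤ M * (K * Real.log (q * n / N)) := by
    calc -(N * (c * K / q)) = -((c * N) * (K * (1 / q))) := by ring
      _ ≤ -(M * (K * (1 / q))) := by gcongr
      _ = M * (K * (-(1 / q))) := by ring
      _ ≤ _ := by gcongr
  have hsq : (q * (c * n) - M) ^ 2 ≤ (1 + c * n) ^ 2 := by
    have h1 : c * (q * n) ≤ c * N := by gcongr
    have h2 : c * N ≤ c * (q * n + n) := by gcongr
    refine sq_le_sq' ?_ ?_ <;> nlinarith
  have hsq' : L / (2 * s) * ((q * (c * n) - M) ^ 2 / q + M) ≤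
      N * (L / (2 * s) * (1 + c * n) ^ 2 / q) + N * (L / (2 * s) * c) := by
    calc L / (2 * s) * ((q * (c * n) - M) ^ 2 / q + M)
        ≤ L / (2 * s) * ((1 + c * n) ^ 2 / q + c * N) := by gcongr
      _ = 1 * (L / (2 * s) * (1 + c * n) ^ 2 / q) + N * (L / (2 * s) * c) := by ring
      _ ≤ _ := by gcongr
  have hA : q * (-l + L * (1 + s / 2)) ≤ N * ((n : ℝ)⁻¹ * (-l + L * (1 + s / 2))) := by
    rw [← mul_assoc]
    have : 0 ≤ -l + L * (1 + s / 2) := by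
      have := neg_nonneg.mpr hl
      positivity
    gcongr
    rw [← div_eq_mul_inv, le_div_iff₀ (by positivity)]
    exact hqN'
  rw [inv_mul_eq_div, inv_mul_eq_div, le_div_iff₀ (by positivity)]
  refine le_trans (le_of_eq ?_) (le_trans (sub_le_sub hlog' (add_le_add hA hsq')) hmain)
  ring

end Rate

/-- A bounded-above sequence satisfying `a n - δ n - C n / (N / n) ≤ a N` with `δ → 0`
converges. -/
lemma exists_tendsto_of_almost_superadditive {a δ C : ℕ → ℝ} (ha : ∀ n, a n ≤ 0)
    (hδ0 : ∀ n, 0 ≤ δ n) (hδ : Tendsto δ atTop (nhds 0))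
    (h : ∀ n N, 0 < n → n ≤ N → a n - δ n - C n / (N / n : ℕ) ≤ a N) :
    ∃ p, Tendsto a atTop (nhds p) := by
  set b : Set.Ioi (0 : ℕ) → ℝ := fun n ↦ a n - δ n
  have hbdd : BddAbove (Set.range b) := by
    refine ⟨0, ?_⟩
    rintro _ ⟨n, rfl⟩
    exact sub_nonpos.mpr ((ha n).trans (hδ0 n))
  have : Nonempty (Set.Ioi (0 : ℕ)) := ⟨⟨1, Nat.one_pos⟩⟩
  refine ⟨⨆ n, b n, tendsto_order.mpr ⟨fun x hx ↦ ?_, fun x hx ↦ ?_⟩⟩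
  · obtain ⟨⟨n, hn⟩, hxn⟩ := exists_lt_of_lt_ciSup hx
    have hlim : Tendsto (fun N : ℕ ↦ a n - δ n - C n / (N / n : ℕ)) atTop
        (nhds (a n - δ n - 0)) := by
      refine tendsto_const_nhds.sub (Tendsto.const_div_atTop ?_ _)
      exact tendsto_natCast_atTop_atTop.comp (Nat.tendsto_div_const_atTop (ne_of_gt hn))
    rw [sub_zero] at hlim
    filter_upwards [hlim.eventually_const_lt hxn, eventually_ge_atTop n] with N hN hnN
    exact hN.trans_le (h n N hn hnN)
  · have hlim : Tendsto (fun N ↦ (⨆ n, b n) + δ N) atTop (nhds ((⨆ n, b n) + 0)) :=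
      tendsto_const_nhds.add hδ
    rw [add_zero] at hlim
    filter_upwards [hlim.eventually_lt_const hx, eventually_gt_atTop 0] with N hN hN0
    have : b ⟨N, hN0⟩ ≤ ⨆ n, b n := le_ciSup hbdd _
    simp only [b] at this
    linarith

/-- The large deviations rate for satisfiability of random `K`-SAT:
`N⁻¹ log p(N, ⌊cN⌋)` converges to a real limit `p(c)` as `N → ∞`. -/
theorem ksat_sat_prob_rate (c : ℝ) (hc : 0 < c) (K : ℕ) (hK : 2 ≤ K) :
    ∃ p : ℝ,
      Tendsto (fun N : ℕ => (N : ℝ)⁻¹ * Real.log (pSat N K ⌊c * (N : ℝ)⌋₊))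
        atTop (nhds p) := by
  have hK0 : K ≠ 0 := by omega
  have hL := clauseCost_nonneg hK0
  refine exists_tendsto_of_almost_superadditive
    (δ := fun n ↦ clauseCost K * (1 + √n / 2) / n + clauseCost K / (2 * √n) * c)
    (C := fun n ↦ c * K + clauseCost K / (2 * √n) * (1 + c * n) ^ 2)
    (fun n ↦ mul_nonpos_of_nonneg_of_nonpos (by positivity) (log_pSat_nonpos _ _))
    (fun n ↦ by positivity) ?_ fun n N hn hnN ↦ ?_
  · have h1 : Tendsto (fun n : ℕ ↦ (√(n : ℝ))⁻¹) atTop (nhds 0) :=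
      tendsto_inv_atTop_zero.comp (Real.tendsto_sqrt_atTop.comp tendsto_natCast_atTop_atTop)
    have h2 := ((tendsto_inv_atTop_nhds_zero_nat (𝕜 := ℝ)).const_mul (clauseCost K)).add
      (h1.const_mul (clauseCost K / 2 * (1 + c)))
    rw [mul_zero, mul_zero, add_zero] at h2
    refine h2.congr fun n ↦ ?_
    rcases Nat.eq_zero_or_pos n with rfl | hn
    · simp
    · have hs : 0 < √(n : ℝ) := Real.sqrt_pos.mpr (by exact_mod_cast hn)
      have hn' : (n : ℝ) = √n * √n := (Real.mul_self_sqrt (Nat.cast_nonneg n)).symm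
      generalize √(n : ℝ) = t at hs hn'
      rw [hn']
      field_simp
      ring
  · exact inv_mul_log_pSat_ge hc hK0 hn hnN (Real.sqrt_pos.mpr (by exact_mod_cast hn))
end
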